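/- arXiv:1302.4055 — 3 statements merged into one kernel-verified Lean document; each statement's English description precedes it below -/
import Mathlib

section
/- Inductive freeness is a combinatorial property: if two hyperplane arrangements A and B have isomorphic intersection lattices, then A is inductively free if and only if B is inductively free. -/
open Module Matrix
open scoped Classical

namespace Arrgt

variable {K : Type*} [Field K]

/-- A (central) hyperplane arrangement in `K^n`: a finite set of kernels of
nonzero linear forms. -/
structure Arrangement (K : Type*) [Field K] (n : ℕ) where
  hyperplanes : Finset (Submodule K (Fin n → K))
  isHyp : ∀ H ∈ hyperplanes, ∃ f : (Fin n → K) →ₗ[K] K, f ≠ 0 ∧ H = LinearMap.ker f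

/-- The deletion `A \ {H}`. -/
noncomputable def Arrangement.delete {n : ℕ} (A : Arrangement K n) (H : Submodule K (Fin n → K)) :
    Arrangement K n :=
  ⟨A.hyperplanes.erase H, fun H' hH' => A.isHyp H' (Finset.mem_of_mem_erase hH')⟩

/-- The empty arrangement of rank `n`. -/
def emptyArr (K : Type*) [Field K] (n : ℕ) : Arrangement K n := ⟨∅, by simp⟩

/-- The linear polynomial in `K[x_1,...,x_n]` attached to a linear form. -/
noncomputable def linPoly {n : ℕ} (f : (Fin n → K) →ₗ[K] K) : MvPolynomial (Fin n) K :=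
  ∑ i, MvPolynomial.C (f (Pi.single i 1)) * MvPolynomial.X i

/-- `Q` is a defining polynomial of the arrangement `A`: a product of linear forms
whose kernels are exactly the hyperplanes of `A`. -/
def IsDefiningPoly {n : ℕ} (A : Arrangement K n) (Q : MvPolynomial (Fin n) K) : Prop :=
  ∃ α : Submodule K (Fin n → K) → ((Fin n → K) →ₗ[K] K),
    (∀ H ∈ A.hyperplanes, α H ≠ 0 ∧ LinearMap.ker (α H) = H) ∧
    Q = ∏ H ∈ A.hyperplanes, linPoly (α H)

/-- Evaluation of a derivation at the polynomial `Q`, as a linear map. -/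
noncomputable def evalDer {n : ℕ} (Q : MvPolynomial (Fin n) K) :
    Derivation K (MvPolynomial (Fin n) K) (MvPolynomial (Fin n) K) →ₗ[MvPolynomial (Fin n) K]
      MvPolynomial (Fin n) K where
  toFun θ := θ Q
  map_add' _ _ := rfl
  map_smul' _ _ := rfl

/-- The module `D(A) = {θ : θ(Q) ∈ Q·S}` of `A`-derivations (for a chosen defining
polynomial `Q`). -/
noncomputable def DerModule {n : ℕ} (Q : MvPolynomial (Fin n) K) :
    Submodule (MvPolynomial (Fin n) K)
      (Derivation K (MvPolynomial (Fin n) K) (MvPolynomial (Fin n) K)) :=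
  Submodule.comap (evalDer Q) (Ideal.span {Q})

/-- `A` is a free arrangement: `D(A)` is a free module over `S = K[x_1,...,x_n]`. -/
def IsFree {n : ℕ} (A : Arrangement K n) : Prop :=
  ∃ Q, IsDefiningPoly A Q ∧ Module.Free (MvPolynomial (Fin n) K) (DerModule Q)

/-- A nonzero derivation is homogeneous of polynomial degree `p` if all its
coefficients are homogeneous of degree `p`. -/
def IsHomogeneousDer {n : ℕ}
    (θ : Derivation K (MvPolynomial (Fin n) K) (MvPolynomial (Fin n) K)) (p : ℕ) : Prop :=
  θ ≠ 0 ∧ ∀ i, (θ (MvPolynomial.X i)).IsHomogeneous p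

/-- `A` is free with exponents the multiset `e`: `D(A)` has a homogeneous basis whose
polynomial degrees form the multiset `e`. -/
def HasExponents {n : ℕ} (A : Arrangement K n) (e : Multiset ℕ) : Prop :=
  ∃ Q, IsDefiningPoly A Q ∧
    ∃ (l : List ℕ) (b : Basis (Fin l.length) (MvPolynomial (Fin n) K) (DerModule Q)),
      (l : Multiset ℕ) = e ∧ ∀ i : Fin l.length, IsHomogeneousDer ((b i : DerModule Q) :
        Derivation K (MvPolynomial (Fin n) K) (MvPolynomial (Fin n) K)) (l.get i)

/-- `B` is (a model, via a linear identification `H ≅ K^n`, of) the restriction `A^H`. -/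
def IsRestriction {n : ℕ} (A : Arrangement K (n + 1)) (H : Submodule K (Fin (n + 1) → K))
    (B : Arrangement K n) : Prop :=
  ∃ e : H ≃ₗ[K] (Fin n → K),
    B.hyperplanes = (A.hyperplanes.erase H).image
      (fun H' => Submodule.map (e : H →ₗ[K] (Fin n → K)) (H'.comap H.subtype))

variable (K) in
/-- The class of inductively free arrangements. -/
inductive InductivelyFree : {n : ℕ} → Arrangement K n → Prop
  | empty (n : ℕ) : InductivelyFree (emptyArr K n)
  | add {n : ℕ} (A : Arrangement K (n + 1)) (H : Submodule K (Fin (n + 1) → K))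
      (hH : H ∈ A.hyperplanes) (B : Arrangement K n) (hB : IsRestriction A H B)
      (e' e'' : Multiset ℕ)
      (h1 : InductivelyFree (A.delete H)) (h2 : InductivelyFree B)
      (h3 : HasExponents (A.delete H) e') (h4 : HasExponents B e'')
      (h5 : e'' ≤ e') : InductivelyFree A

variable (K) in
/-- The class of recursively free arrangements. -/
inductive RecursivelyFree : {n : ℕ} → Arrangement K n → Prop
  | empty (n : ℕ) : RecursivelyFree (emptyArr K n)
  | add {n : ℕ} (A : Arrangement K (n + 1)) (H : Submodule K (Fin (n + 1) → K))
      (hH : H ∈ A.hyperplanes) (B : Arrangement K n) (hB : IsRestriction A H B)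
      (e' e'' : Multiset ℕ)
      (h1 : RecursivelyFree (A.delete H)) (h2 : RecursivelyFree B)
      (h3 : HasExponents (A.delete H) e') (h4 : HasExponents B e'')
      (h5 : e'' ≤ e') : RecursivelyFree A
  | del {n : ℕ} (A : Arrangement K (n + 1)) (H : Submodule K (Fin (n + 1) → K))
      (hH : H ∈ A.hyperplanes) (B : Arrangement K n) (hB : IsRestriction A H B)
      (e e'' : Multiset ℕ)
      (h1 : RecursivelyFree A) (h2 : RecursivelyFree B)
      (h3 : HasExponents A e) (h4 : HasExponents B e'')
      (h5 : e'' ≤ e) : RecursivelyFree (A.delete H)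

/-- The intersection lattice of a set of hyperplanes: all intersections of finite
subsets (including the ambient space `⊤` as the empty intersection). -/
def setLattice {n : ℕ} (𝓐 : Set (Submodule K (Fin n → K))) : Set (Submodule K (Fin n → K)) :=
  {X | ∃ s : Finset (Submodule K (Fin n → K)), ↑s ⊆ 𝓐 ∧ X = s.inf id}

/-- The intersection lattice of an arrangement. -/
def Arrangement.lattice {n : ℕ} (A : Arrangement K n) : Set (Submodule K (Fin n → K)) :=
  setLattice (↑A.hyperplanes)

/-- The linear form `x ↦ ∑ v i * x i` attached to a normal vector `v`. -/
noncomputable def lf {n : ℕ} (v : Fin n → K) : (Fin n → K) →ₗ[K] K :=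
  ∑ i, v i • LinearMap.proj i

lemma lf_single {n : ℕ} (v : Fin n → K) (j : Fin n) : lf v (Pi.single j 1) = v j := by
  simp [lf, Pi.single_apply, mul_ite, Finset.sum_ite_eq']

lemma lf_ne_zero {n : ℕ} {v : Fin n → K} (hv : v ≠ 0) : lf v ≠ 0 := by
  intro h
  apply hv
  funext j
  have := congrArg (fun f : (Fin n → K) →ₗ[K] K => f (Pi.single j 1)) h
  simpa [lf_single] using this

/-- The hyperplane `v^⊥` with normal vector `v`. -/
noncomputable def perp {n : ℕ} (v : Fin n → K) : Submodule K (Fin n → K) :=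
  LinearMap.ker (lf v)

/-- Build an arrangement from a finite set of nonzero normal vectors. -/
noncomputable def mkArr {n : ℕ} (vs : Finset (Fin n → K)) (h : (0 : Fin n → K) ∉ vs) :
    Arrangement K n :=
  ⟨vs.image perp, by
    intro H hH
    obtain ⟨v, hv, rfl⟩ := Finset.mem_image.mp hH
    exact ⟨lf v, lf_ne_zero (fun h0 => h (h0 ▸ hv)), rfl⟩⟩

end Arrgt

namespace Arrgt
open MvPolynomial

section LinearForms

variable {K : Type*} [Field K] {n m : ℕ}

/-- `linPoly` as a linear map. -/
noncomputable def linHom (K : Type*) [Field K] (n : ℕ) :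
    ((Fin n → K) →ₗ[K] K) →ₗ[K] MvPolynomial (Fin n) K where
  toFun := linPoly
  map_add' f g := by simp [linPoly, add_mul, Finset.sum_add_distrib]
  map_smul' c f := by simp [linPoly, Finset.smul_sum, MvPolynomial.smul_eq_C_mul, mul_assoc]

lemma linPoly_add (f g : (Fin n → K) →ₗ[K] K) : linPoly (f + g) = linPoly f + linPoly g :=
  (linHom K n).map_add f g

lemma linPoly_smul (c : K) (f : (Fin n → K) →ₗ[K] K) : linPoly (c • f) = c • linPoly f :=
  (linHom K n).map_smul c f

lemma linPoly_zero : linPoly (0 : (Fin n → K) →ₗ[K] K) = 0 := (linHom K n).map_zero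

lemma linPoly_proj (i : Fin n) : linPoly (LinearMap.proj (φ := fun _ => K) i) = X i := by
  simp [linPoly, Pi.single_apply, ite_mul]

lemma coeff_linPoly (f : (Fin n → K) →ₗ[K] K) (i : Fin n) :
    (linPoly f).coeff (Finsupp.single i 1) = f (Pi.single i 1) := by
  simp [linPoly, coeff_sum, coeff_C_mul, coeff_X, Finsupp.single_left_inj]

lemma linPoly_eq_zero {f : (Fin n → K) →ₗ[K] K} : linPoly f = 0 ↔ f = 0 := by
  refine ⟨fun h => ?_, fun h => h ▸ linPoly_zero⟩
  refine LinearMap.pi_ext' fun i => LinearMap.ext_ring ?_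
  simp [← coeff_linPoly, h]

lemma linPoly_isHomogeneous (f : (Fin n → K) →ₗ[K] K) : (linPoly f).IsHomogeneous 1 :=
  IsHomogeneous.sum _ _ _ fun i _ => isHomogeneous_C_mul_X _ i

lemma linPoly_eq_sum (f : (Fin n → K) →ₗ[K] K) : linPoly f = ∑ i, f (Pi.single i 1) • X i := by
  simp [linPoly, MvPolynomial.smul_eq_C_mul]

lemma sum_smul_proj (f : (Fin n → K) →ₗ[K] K) :
    ∑ i, f (Pi.single i 1) • (LinearMap.proj i : (Fin n → K) →ₗ[K] K) = f := by
  refine LinearMap.pi_ext' fun i => LinearMap.ext_ring ?_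
  simp [Pi.single_apply]

/-- The substitution of linear forms dual to a linear map. -/
noncomputable def subst (T : (Fin m → K) →ₗ[K] (Fin n → K)) :
    MvPolynomial (Fin n) K →ₐ[K] MvPolynomial (Fin m) K :=
  aeval fun i => linPoly (LinearMap.proj i ∘ₗ T)

lemma subst_linPoly (T : (Fin m → K) →ₗ[K] (Fin n → K)) (f : (Fin n → K) →ₗ[K] K) :
    subst T (linPoly f) = linPoly (f ∘ₗ T) := by
  have h : f ∘ₗ T = ∑ i, f (Pi.single i 1) • (LinearMap.proj i ∘ₗ T) := by
    ext1 j
    refine LinearMap.ext_ring ?_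
    conv_lhs => rw [← sum_smul_proj f]
    simp
  rw [h, linPoly_eq_sum f, show ∀ g, linPoly g = linHom K m g from fun _ => rfl, map_sum, map_sum]
  refine Finset.sum_congr rfl fun i _ => ?_
  rw [map_smul, map_smul, subst, aeval_X]
  rfl

lemma subst_isHomogeneous (T : (Fin m → K) →ₗ[K] (Fin n → K)) {p : MvPolynomial (Fin n) K} {d : ℕ}
    (hp : p.IsHomogeneous d) : (subst T p).IsHomogeneous d := by
  have h := hp.aeval (fun i => linPoly (LinearMap.proj i ∘ₗ T)) fun i => linPoly_isHomogeneous _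
  rwa [one_mul] at h

lemma exists_eq_smul_of_ker_le {f g : (Fin n → K) →ₗ[K] K}
    (h : LinearMap.ker f ≤ LinearMap.ker g) : ∃ c : K, g = c • f := by
  have := mem_span_of_iInf_ker_le_ker (ι := Unit) (L := fun _ => f) (K := g) (by simpa using h)
  obtain ⟨c, hc⟩ := Submodule.mem_span_singleton.1 (by simpa using this)
  exact ⟨c, hc.symm⟩

/-- A parametrization of the hyperplane `ker f`, with a retraction. -/
lemma exists_parametrization {f : (Fin (n + 1) → K) →ₗ[K] K} (hf : f ≠ 0) :
    ∃ ι : (Fin n → K) →ₗ[K] (Fin (n + 1) → K), Function.Injective ι ∧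
      LinearMap.range ι = LinearMap.ker f := by
  have h : finrank K (LinearMap.ker f) = finrank K (Fin n → K) := by
    have h1 := LinearMap.finrank_range_add_finrank_ker f
    rw [LinearMap.range_eq_top.2 (LinearMap.surjective hf)] at h1
    simp at h1 ⊢
    omega
  let e := LinearEquiv.ofFinrankEq _ _ h
  refine ⟨(LinearMap.ker f).subtype ∘ₗ e.symm.toLinearMap, ?_, ?_⟩
  · simpa using Subtype.val_injective.comp e.symm.injective
  · rw [LinearMap.range_comp]; simp

lemma subst_eq_zero_iff {f : (Fin n → K) →ₗ[K] K}
    {ι : (Fin m → K) →ₗ[K] (Fin n → K)} (hι : Function.Injective ι)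
    (hr : LinearMap.range ι = LinearMap.ker f) (p : MvPolynomial (Fin n) K) :
    subst ι p = 0 ↔ linPoly f ∣ p := by
  obtain ⟨r, hr'⟩ := ι.exists_leftInverse_of_injective (LinearMap.ker_eq_bot.2 hι)
  have hz : subst ι (linPoly f) = 0 := by
    rw [subst_linPoly, linPoly_eq_zero]
    ext1 i
    exact LinearMap.ext_ring (by
      have : ι (Pi.single i 1) ∈ LinearMap.ker f := hr ▸ LinearMap.mem_range_self _ _
      simpa using this)
  refine ⟨fun h => ?_, fun ⟨q, hq⟩ => by rw [hq, map_mul, hz, zero_mul]⟩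
  have key : (Ideal.Quotient.mkₐ K (Ideal.span {linPoly f})).comp ((subst r).comp (subst ι)) =
      Ideal.Quotient.mkₐ K (Ideal.span {linPoly f}) := by
    refine MvPolynomial.algHom_ext fun i => ?_
    obtain ⟨c, hc⟩ := exists_eq_smul_of_ker_le (f := f)
      (g := LinearMap.proj i ∘ₗ (ι ∘ₗ r) - LinearMap.proj i) (by
        rw [← hr]
        rintro _ ⟨y, rfl⟩
        have : r (ι y) = y := LinearMap.congr_fun hr' y
        simp [this])
    simp only [AlgHom.comp_apply, Ideal.Quotient.mkₐ_eq_mk, Ideal.Quotient.eq,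
      Ideal.mem_span_singleton]
    rw [← linPoly_proj, subst_linPoly, subst_linPoly, LinearMap.comp_assoc]
    rw [sub_eq_iff_eq_add] at hc
    rw [hc, linPoly_add, add_sub_cancel_right, linPoly_smul]
    exact dvd_smul_of_dvd c dvd_rfl
  have := AlgHom.congr_fun key p
  simp only [AlgHom.comp_apply, h, map_zero, Ideal.Quotient.mkₐ_eq_mk] at this
  rwa [eq_comm, Ideal.Quotient.eq_zero_iff_mem, Ideal.mem_span_singleton] at this

lemma linPoly_prime {f : (Fin n → K) →ₗ[K] K} (hf : f ≠ 0) : Prime (linPoly f) := by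
  obtain _ | n := n
  · exact absurd (Subsingleton.elim f 0) hf
  obtain ⟨ι, hι, hr⟩ := exists_parametrization hf
  refine ⟨by rwa [Ne, linPoly_eq_zero], fun h => ?_, fun a b h => ?_⟩
  · have := (subst_eq_zero_iff hι hr 1).2 h.dvd
    simp at this
  · simpa [← subst_eq_zero_iff hι hr] using h

lemma ker_eq_of_linPoly_dvd {f g : (Fin n → K) →ₗ[K] K} (hf : f ≠ 0) (hg : g ≠ 0)
    (h : linPoly f ∣ linPoly g) : LinearMap.ker f = LinearMap.ker g := by
  obtain _ | n := n
  · exact absurd (Subsingleton.elim f 0) hf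
  obtain ⟨ι, hι, hr⟩ := exists_parametrization hf
  have h0 := (subst_eq_zero_iff hι hr _).2 h
  rw [subst_linPoly, linPoly_eq_zero] at h0
  have hle : LinearMap.ker f ≤ LinearMap.ker g := by
    rw [← hr]
    rintro _ ⟨y, rfl⟩
    exact LinearMap.congr_fun h0 y
  obtain ⟨c, rfl⟩ := exists_eq_smul_of_ker_le hle
  rw [LinearMap.ker_smul]
  rintro rfl
  simp at hg

end LinearForms

section Derivations

variable {K : Type*} [Field K] {n m : ℕ}

lemma Arrangement.ne_zero {A : Arrangement K n} {f : (Fin n → K) →ₗ[K] K}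
    (h : LinearMap.ker f ∈ A.hyperplanes) : f ≠ 0 := by
  rintro rfl
  obtain ⟨g, hg, h⟩ := A.isHyp _ h
  rw [LinearMap.ker_zero] at h
  exact hg (LinearMap.ker_eq_top.1 h.symm)

variable (K n) in
/-- The module of polynomial derivations. -/
abbrev Der := Derivation K (MvPolynomial (Fin n) K) (MvPolynomial (Fin n) K)

lemma der_sum_apply {ι : Type*} (s : Finset ι) (w : ι → Der K n) (p : MvPolynomial (Fin n) K) :
    (∑ i ∈ s, w i) p = ∑ i ∈ s, w i p := by
  induction s using Finset.induction_on with
  | empty => simp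
  | insert a s ha ih => rw [Finset.sum_insert ha, Finset.sum_insert ha, Derivation.add_apply, ih]

/-- The module of `A`-derivations, described one hyperplane at a time. -/
def derSub (A : Arrangement K n) : Submodule (MvPolynomial (Fin n) K) (Der K n) where
  carrier := {θ | ∀ f : (Fin n → K) →ₗ[K] K, LinearMap.ker f ∈ A.hyperplanes →
    linPoly f ∣ θ (linPoly f)}
  add_mem' ha hb f hf := dvd_add (ha f hf) (hb f hf)
  zero_mem' _ _ := dvd_zero _
  smul_mem' c _ h f hf := (h f hf).mul_left c

lemma prod_dvd_derivation {ι : Type*} (s : Finset ι) (p : ι → MvPolynomial (Fin n) K) (θ : Der K n)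
    (h : ∀ i ∈ s, p i ∣ θ (p i)) : ∏ i ∈ s, p i ∣ θ (∏ i ∈ s, p i) := by
  induction s using Finset.induction_on with
  | empty => simp
  | insert a s ha ih =>
    rw [Finset.prod_insert ha, Derivation.leibniz, smul_eq_mul, smul_eq_mul]
    refine dvd_add (mul_dvd_mul_left _ (ih fun i hi => h i (Finset.mem_insert_of_mem hi))) ?_
    rw [mul_comm]
    exact mul_dvd_mul_left _ (h a (Finset.mem_insert_self _ _))

lemma derModule_eq {A : Arrangement K n} {Q : MvPolynomial (Fin n) K} (hQ : IsDefiningPoly A Q) :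
    DerModule Q = derSub A := by
  obtain ⟨α, hα, rfl⟩ := hQ
  ext θ
  change _ ∈ Ideal.span _ ↔ _
  rw [Ideal.mem_span_singleton]
  change _ ∣ θ _ ↔ _
  constructor
  · intro h f hf
    obtain ⟨h0, hk⟩ := hα _ hf
    obtain ⟨c, hc⟩ := exists_eq_smul_of_ker_le hk.le
    have hc0 : c ≠ 0 := by
      rintro rfl
      exact A.ne_zero hf (by simpa using hc)
    set g := α (LinearMap.ker f)
    have hg : linPoly g ∣ θ (linPoly g) := by
      rw [← Finset.mul_prod_erase _ _ hf, Derivation.leibniz, smul_eq_mul, smul_eq_mul] at h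
      have h1 := (dvd_add_right (Dvd.intro _ rfl)).1 ((Dvd.intro _ rfl).trans h)
      refine ((linPoly_prime h0).dvd_or_dvd h1).resolve_left fun h2 => ?_
      obtain ⟨H, hH, h3⟩ := ((linPoly_prime h0).dvd_finsetProd_iff _).1 h2
      rw [Finset.mem_erase] at hH
      have := ker_eq_of_linPoly_dvd h0 (hα H hH.2).1 h3
      rw [(hα H hH.2).2, hk] at this
      exact hH.1 this.symm
    rw [hc, linPoly_smul, Derivation.map_smul]
    obtain ⟨q, hq⟩ := hg
    exact ⟨q, by rw [hq, smul_mul_assoc]⟩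
  · intro h
    exact prod_dvd_derivation _ _ _ fun H hH => h _ (by rwa [(hα H hH).2])

lemma exists_isDefiningPoly (A : Arrangement K n) : ∃ Q, IsDefiningPoly A Q := by
  choose! α hα using A.isHyp
  exact ⟨_, α, fun H hH => ⟨(hα H hH).1, (hα H hH).2.symm⟩, rfl⟩

/-- `w` is a homogeneous basis of the module of `A`-derivations, with degrees `d`. -/
structure IsHomBasis {ι : Type*} (A : Arrangement K n) (d : ι → ℕ) (w : ι → Der K n) : Prop where
  indep : LinearIndependent (MvPolynomial (Fin n) K) w
  span_eq : Submodule.span (MvPolynomial (Fin n) K) (Set.range w) = derSub A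
  hom : ∀ i j, (w i (X j)).IsHomogeneous (d i)

lemma linearIndependent_coe_basis {R M ι : Type*} [CommRing R] [AddCommGroup M] [Module R M]
    {N : Submodule R M} (b : Basis ι R N) : LinearIndependent R fun i => (b i : M) :=
  b.linearIndependent.map' N.subtype (Submodule.ker_subtype _)

lemma span_range_coe_basis {R M ι : Type*} [CommRing R] [AddCommGroup M] [Module R M]
    {N : Submodule R M} (b : Basis ι R N) :
    Submodule.span R (Set.range fun i => (b i : M)) = N := by
  have h := congrArg (Submodule.map N.subtype) b.span_eq
  rwa [Submodule.map_span, ← Set.range_comp, Submodule.map_subtype_top] at h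

lemma HasExponents.exists_isHomBasis {A : Arrangement K n} {e : Multiset ℕ}
    (h : HasExponents A e) : ∃ (k : ℕ) (d : Fin k → ℕ) (w : Fin k → Der K n),
      IsHomBasis A d w ∧ e = Finset.univ.val.map d := by
  obtain ⟨Q, hQ, l, b, rfl, hb⟩ := h
  refine ⟨l.length, l.get, fun i => b i, ⟨?_, ?_, fun i j => (hb i).2 j⟩, ?_⟩
  · exact linearIndependent_coe_basis b
  · rw [← derModule_eq hQ, span_range_coe_basis b]
  · rw [Fin.univ_val_map, List.ofFn_get]

lemma IsHomBasis.hasExponents {A : Arrangement K n} {k : ℕ} {d : Fin k → ℕ} {w : Fin k → Der K n}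
    (h : IsHomBasis A d w) : HasExponents A (Finset.univ.val.map d) := by
  obtain ⟨Q, hQ⟩ := exists_isDefiningPoly A
  have hl : (List.ofFn d).length = k := List.length_ofFn
  have hs : Submodule.span _ (Set.range w) = DerModule Q := h.span_eq.trans (derModule_eq hQ).symm
  let b := ((Basis.span h.indep).map (LinearEquiv.ofEq _ _ hs)).reindex (finCongr hl.symm)
  have hb : ∀ i, ((b i : DerModule Q) : Der K n) = w (Fin.cast hl i) := fun i => by
    simp [b, Basis.span_apply]
  refine ⟨Q, hQ, List.ofFn d, b, ?_, fun i => ⟨?_, fun j => ?_⟩⟩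
  · rw [Fin.univ_val_map]
  · rw [hb]
    exact h.indep.ne_zero _
  · rw [hb]
    rw [List.get_ofFn]
    exact h.hom (Fin.cast hl i) j

lemma hom_linPoly {θ : Der K n} {d : ℕ} (h : ∀ j, (θ (X j)).IsHomogeneous d)
    (f : (Fin n → K) →ₗ[K] K) : (θ (linPoly f)).IsHomogeneous d := by
  rw [linPoly_eq_sum, map_sum]
  refine IsHomogeneous.sum _ _ _ fun i _ => ?_
  rw [Derivation.map_smul, MvPolynomial.smul_eq_C_mul]
  exact (h i).C_mul _

lemma hasExponents_empty (K : Type*) [Field K] (n : ℕ) :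
    HasExponents (emptyArr K n) (Multiset.replicate n 0) := by
  have h : IsHomBasis (emptyArr K n) (fun _ => 0)
      (fun i : Fin n => (pderiv i : Der K n)) := by
    refine ⟨?_, ?_, fun i j => ?_⟩
    · rw [Fintype.linearIndependent_iff]
      intro g hg i
      have := congrArg (fun θ : Der K n => θ (X i)) hg
      simpa [der_sum_apply, pderiv_X, Pi.single_apply] using this
    · refine le_antisymm (fun θ _ f hf => by simp [emptyArr] at hf) fun θ _ => ?_
      have : θ = ∑ i, θ (X i) • (pderiv i : Der K n) := by
        refine derivation_ext fun j => ?_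
        simp [der_sum_apply, pderiv_X, Pi.single_apply]
      rw [this]
      exact Submodule.sum_mem _ fun i _ =>
        Submodule.smul_mem _ _ (Submodule.subset_span (Set.mem_range_self i))
    · rw [pderiv_X, Pi.single_apply]
      split_ifs
      exacts [isHomogeneous_one _ _, isHomogeneous_zero _ _ _]
  simpa using h.hasExponents

end Derivations

section Homogeneous

variable {K : Type*} [Field K] {n : ℕ}

lemma homogeneousComponent_mul_of_le {p q : MvPolynomial (Fin n) K} {a b : ℕ}
    (hq : q.IsHomogeneous a) (h : a ≤ b) :
    homogeneousComponent b (p * q) = homogeneousComponent (b - a) p * q := by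
  let := MvPolynomial.gradedAlgebra (σ := Fin n) (R := K)
  rw [← decomposition.decompose'_apply, ← decomposition.decompose'_apply]
  exact DirectSum.coe_decompose_mul_of_right_mem_of_le (homogeneousSubmodule (Fin n) K)
    (a := p) (show q ∈ homogeneousSubmodule (Fin n) K a from hq) h

lemma homogeneousComponent_mul_of_lt {p q : MvPolynomial (Fin n) K} {a b : ℕ}
    (hq : q.IsHomogeneous a) (h : b < a) : homogeneousComponent b (p * q) = 0 := by
  let := MvPolynomial.gradedAlgebra (σ := Fin n) (R := K)
  rw [← decomposition.decompose'_apply]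
  exact DirectSum.coe_decompose_mul_of_right_mem_of_not_le (homogeneousSubmodule (Fin n) K)
    (a := p) (show q ∈ homogeneousSubmodule (Fin n) K a from hq) h.not_ge

/-- A homogeneous multiple of a homogeneous polynomial has a homogeneous cofactor. -/
lemma exists_homogeneous_cofactor {p q : MvPolynomial (Fin n) K} {a b : ℕ}
    (hp : p.IsHomogeneous a) (hq : q.IsHomogeneous b) (h : p ∣ q) :
    ∃ g, q = g * p ∧ (a ≤ b → g.IsHomogeneous (b - a)) ∧ (b < a → g = 0) := by
  obtain ⟨g, rfl⟩ := h
  rw [mul_comm] at hq ⊢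
  have h1 := homogeneousComponent_eq_self hq
  obtain h | h := lt_or_ge b a
  · rw [homogeneousComponent_mul_of_lt hp h] at h1
    exact ⟨0, by rw [← h1, zero_mul], fun h' => absurd h h'.not_gt, fun _ => rfl⟩
  · rw [homogeneousComponent_mul_of_le hp h] at h1
    exact ⟨_, h1.symm, fun _ => homogeneousComponent_isHomogeneous _ _,
      fun h' => absurd h h'.not_ge⟩

lemma mem_span_of_homogeneous {κ : Type*} [Fintype κ] {d : κ → ℕ} {w : κ → Der K n}
    (hw : ∀ i j, (w i (X j)).IsHomogeneous (d i)) {θ : Der K n} {b : ℕ}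
    (hθ : ∀ j, (θ (X j)).IsHomogeneous b)
    (h : θ ∈ Submodule.span (MvPolynomial (Fin n) K) (Set.range w)) :
    θ ∈ Submodule.span (MvPolynomial (Fin n) K)
      (Set.range fun i : {i // d i ≤ b} => w i) := by
  obtain ⟨c, hc⟩ := (Submodule.mem_span_range_iff_exists_fun _).1 h
  have key : θ = ∑ i, (if d i ≤ b then homogeneousComponent (b - d i) (c i) else 0) • w i := by
    refine derivation_ext fun j => ?_
    rw [← homogeneousComponent_eq_self (hθ j), ← hc]
    simp only [der_sum_apply, Derivation.coe_smul, Pi.smul_apply,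
      smul_eq_mul, map_sum]
    refine Finset.sum_congr rfl fun i _ => ?_
    split_ifs with hi
    · exact homogeneousComponent_mul_of_le (hw i j) hi
    · rw [zero_mul]
      exact homogeneousComponent_mul_of_lt (hw i j) (not_le.1 hi)
  rw [key]
  refine Submodule.sum_mem _ fun i _ => ?_
  split_ifs with hi
  · exact Submodule.smul_mem _ _ (Submodule.subset_span ⟨⟨i, hi⟩, rfl⟩)
  · rw [zero_smul]; exact zero_mem _

lemma card_le_of_homogeneous {ι κ : Type*} [Fintype ι] [Fintype κ] {d : κ → ℕ} {w : κ → Der K n}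
    (hw : ∀ i j, (w i (X j)).IsHomogeneous (d i)) {v : ι → Der K n} {c : ι → ℕ} {b : ℕ}
    (hv : ∀ i j, (v i (X j)).IsHomogeneous (c i)) (hc : ∀ i, c i ≤ b)
    (hi : LinearIndependent (MvPolynomial (Fin n) K) v)
    (h : ∀ i, v i ∈ Submodule.span (MvPolynomial (Fin n) K) (Set.range w)) :
    Fintype.card ι ≤ Fintype.card {i // d i ≤ b} := by
  have := linearIndependent_le_span_aux' v hi (Set.range fun i : {i // d i ≤ b} => w i) (by
    rintro _ ⟨i, rfl⟩
    have := mem_span_of_homogeneous hw (hv i) (h i)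
    refine Submodule.span_mono ?_ this
    rintro _ ⟨k, rfl⟩
    exact ⟨⟨k, k.2.trans (hc i)⟩, rfl⟩)
  exact this.trans (Fintype.card_range_le _)

lemma card_subtype_le_eq_countP {k : ℕ} (d : Fin k → ℕ) (b : ℕ) :
    Fintype.card {i // d i ≤ b} = (Finset.univ.val.map d).countP (· ≤ b) := by
  rw [Multiset.countP_map, Fintype.card_subtype]
  rfl

lemma multiset_eq_of_countP_le {e f : Multiset ℕ}
    (h : ∀ b, e.countP (· ≤ b) = f.countP (· ≤ b)) : e = f := by
  have hs : ∀ (s : Multiset ℕ) b, s.countP (· ≤ b + 1) = s.countP (· ≤ b) + s.count (b + 1) := by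
    intro s b
    induction s using Multiset.induction_on with
    | empty => simp
    | cons a s ih =>
      simp only [Multiset.countP_cons, Multiset.count_cons, ih]
      split_ifs <;> omega
  have h0 : ∀ s : Multiset ℕ, s.countP (· ≤ 0) = s.count 0 := fun s => by
    simp [Multiset.count, eq_comm]
  ext b
  obtain _ | b := b
  · rw [← h0, ← h0, h]
  · have h1 := h (b + 1)
    rw [hs, hs, h b] at h1
    omega

lemma HasExponents.unique {A : Arrangement K n} {e f : Multiset ℕ} (he : HasExponents A e)
    (hf : HasExponents A f) : e = f := by
  have key : ∀ {e f : Multiset ℕ}, HasExponents A e → HasExponents A f →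
      ∀ b, e.countP (· ≤ b) ≤ f.countP (· ≤ b) := by
    intro e f he hf b
    obtain ⟨k, d, v, hv, rfl⟩ := he.exists_isHomBasis
    obtain ⟨l, c, w, hw, rfl⟩ := hf.exists_isHomBasis
    rw [← card_subtype_le_eq_countP, ← card_subtype_le_eq_countP]
    refine card_le_of_homogeneous hw.hom (v := fun i : {i // d i ≤ b} => v i)
      (fun i j => hv.hom i j) (fun i => i.2) (hv.indep.comp _ Subtype.val_injective) fun i => ?_
    rw [hw.span_eq, ← hv.span_eq]
    exact Submodule.subset_span (Set.mem_range_self _)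
  exact multiset_eq_of_countP_le fun b => le_antisymm (key he hf b) (key hf he b)

end Homogeneous

section Addition

variable {K : Type*} [Field K] {n m : ℕ}

lemma mem_derSub_iff {A : Arrangement K n} {α : (Fin n → K) →ₗ[K] K}
    (hα : LinearMap.ker α ∈ A.hyperplanes) {θ : Der K n} :
    θ ∈ derSub A ↔ θ ∈ derSub (A.delete (LinearMap.ker α)) ∧ linPoly α ∣ θ (linPoly α) := by
  refine ⟨fun h => ⟨fun f hf => h f (Finset.mem_of_mem_erase hf), h α hα⟩, fun h f hf => ?_⟩
  by_cases hk : LinearMap.ker f = LinearMap.ker α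
  · obtain ⟨c, rfl⟩ := exists_eq_smul_of_ker_le hk.ge
    obtain ⟨q, hq⟩ := h.2
    rw [linPoly_smul, Derivation.map_smul]
    exact ⟨q, by rw [hq, smul_mul_assoc]⟩
  · exact h.1 f (Finset.mem_erase.2 ⟨hk, hf⟩)

lemma mem_derSub_of_smul_mem {A : Arrangement K n} {α : (Fin n → K) →ₗ[K] K} (hα : α ≠ 0)
    (h : LinearMap.ker α ∉ A.hyperplanes) {θ : Der K n} (hθ : linPoly α • θ ∈ derSub A) :
    θ ∈ derSub A := by
  intro f hf
  have h1 : linPoly f ∣ linPoly α * θ (linPoly f) := hθ f hf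
  refine ((linPoly_prime (A.ne_zero hf)).dvd_or_dvd h1).resolve_left fun h2 => h ?_
  rwa [← ker_eq_of_linPoly_dvd (A.ne_zero hf) hα h2]

lemma linearIndependent_sub_smul {R M ι : Type*} [CommRing R] [AddCommGroup M] [Module R M]
    [Fintype ι] {w : ι → M} (h : LinearIndependent R w) (i : ι) {f : ι → R} (hi : f i = 0) :
    LinearIndependent R fun j => w j - f j • w i := by
  rw [Fintype.linearIndependent_iff] at h ⊢
  intro g hg
  have h1 : ∑ j, (g j - if j = i then ∑ l, g l * f l else 0) • w j = 0 := by
    rw [← hg]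
    simp [sub_smul, smul_sub, ite_smul, Finset.sum_smul, mul_smul]
  have h2 := h _ h1
  have h3 : ∀ j, j ≠ i → g j = 0 := fun j hj => by simpa [hj] using h2 j
  intro j
  by_cases hj : j = i
  · subst hj
    have h4 : ∑ l, g l * f l = 0 := Finset.sum_eq_zero fun l _ => by
      by_cases hl : l = j
      · rw [hl, hi, mul_zero]
      · rw [h3 l hl, zero_mul]
    simpa [h4] using h2 j
  · exact h3 j hj

lemma span_range_sub_smul {R M ι : Type*} [CommRing R] [AddCommGroup M] [Module R M]
    (w : ι → M) (i : ι) {f : ι → R} (hi : f i = 0) :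
    Submodule.span R (Set.range fun j => w j - f j • w i) = Submodule.span R (Set.range w) := by
  refine le_antisymm (Submodule.span_le.2 ?_) (Submodule.span_le.2 ?_)
  · rintro _ ⟨j, rfl⟩
    exact Submodule.sub_mem _ (Submodule.subset_span ⟨j, rfl⟩)
      (Submodule.smul_mem _ _ (Submodule.subset_span ⟨i, rfl⟩))
  · rintro _ ⟨j, rfl⟩
    have h1 : w j = (w j - f j • w i) + f j • (w i - f i • w i) := by simp [hi]
    rw [h1]
    exact Submodule.add_mem _ (Submodule.subset_span ⟨j, rfl⟩)
      (Submodule.smul_mem _ _ (Submodule.subset_span ⟨i, rfl⟩))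

lemma sum_sub_mul_smul {R M ι : Type*} [CommRing R] [AddCommGroup M] [Module R M] [Fintype ι]
    (w : ι → M) (g c : ι → R) (a : R) :
    ∑ i, (g i - a * c i) • w i = ∑ i, g i • w i - a • ∑ i, c i • w i := by
  simp only [sub_smul, Finset.sum_sub_distrib, Finset.smul_sum, mul_smul]

lemma IsHomBasis.shear {ι : Type*} [Fintype ι] {A : Arrangement K n} {d : ι → ℕ} {w : ι → Der K n}
    (h : IsHomBasis A d w) (i : ι) {f : ι → MvPolynomial (Fin n) K} (hi : f i = 0)
    (hf : ∀ j l, (f j * w i (X l)).IsHomogeneous (d j)) :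
    IsHomBasis A d fun j => w j - f j • w i :=
  ⟨linearIndependent_sub_smul h.indep i hi, (span_range_sub_smul w i hi).trans h.span_eq,
    fun j l => (h.hom j l).sub (hf j l)⟩

lemma IsHomBasis.scale {ι : Type*} [Fintype ι] {A : Arrangement K n} {α : (Fin n → K) →ₗ[K] K}
    (hα : LinearMap.ker α ∈ A.hyperplanes) {d : ι → ℕ} {w : ι → Der K n}
    (h : IsHomBasis (A.delete (LinearMap.ker α)) d w) (i : ι)
    (hi : ¬ linPoly α ∣ w i (linPoly α)) (hj : ∀ j ≠ i, linPoly α ∣ w j (linPoly α)) :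
    IsHomBasis A (Function.update d i (d i + 1)) (Function.update w i (linPoly α • w i)) := by
  have hp := linPoly_prime (A.ne_zero hα)
  have hu : ∀ j, Function.update w i (linPoly α • w i) j =
      (if j = i then linPoly α else 1) • w j := fun j => by
    by_cases hj : j = i
    · subst hj; simp
    · simp [hj]
  refine ⟨?_, ?_, fun j l => ?_⟩
  · rw [Fintype.linearIndependent_iff]
    intro g hg j
    simp only [hu, smul_smul] at hg
    have h1 := Fintype.linearIndependent_iff.1 h.indep _ hg j
    refine (mul_eq_zero.1 h1).resolve_right ?_
    split_ifs
    exacts [hp.ne_zero, one_ne_zero]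
  · refine le_antisymm (Submodule.span_le.2 ?_) fun θ hθ => ?_
    · rintro _ ⟨j, rfl⟩
      have hw : w j ∈ derSub (A.delete (LinearMap.ker α)) :=
        h.span_eq ▸ Submodule.subset_span ⟨j, rfl⟩
      rw [SetLike.mem_coe, mem_derSub_iff hα, hu]
      refine ⟨Submodule.smul_mem _ _ hw, ?_⟩
      split_ifs with h1
      · exact Dvd.intro _ rfl
      · simpa using hj j h1
    · rw [mem_derSub_iff hα, ← h.span_eq, Submodule.mem_span_range_iff_exists_fun] at hθ
      obtain ⟨⟨g, rfl⟩, hd⟩ := hθ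
      rw [der_sum_apply, ← Finset.add_sum_erase _ _ (Finset.mem_univ i)] at hd
      have h1 : linPoly α ∣ g i * w i (linPoly α) := by
        refine (dvd_add_left (Finset.dvd_sum fun j hj' => ?_)).1 hd
        exact (hj j (Finset.ne_of_mem_erase hj')).mul_left (g j)
      obtain ⟨q, hq⟩ := (hp.dvd_or_dvd h1).resolve_right hi
      refine Submodule.sum_mem _ fun j _ => ?_
      have hm : Function.update w i (linPoly α • w i) j ∈
        Submodule.span (MvPolynomial (Fin n) K)
          (Set.range (Function.update w i (linPoly α • w i))) := Submodule.subset_span ⟨j, rfl⟩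
      rw [hu] at hm
      split_ifs at hm with hji
      · subst hji
        rw [hq, mul_comm, mul_smul]
        exact Submodule.smul_mem _ _ hm
      · rw [one_smul] at hm
        exact Submodule.smul_mem _ _ hm
  · by_cases hj : j = i
    · subst hj
      simpa [add_comm] using (linPoly_isHomogeneous α).mul (h.hom j l)
    · simpa [hj] using h.hom j l

lemma subst_leftInverse {ι : (Fin n → K) →ₗ[K] (Fin m → K)} {r : (Fin m → K) →ₗ[K] (Fin n → K)}
    (hr : r ∘ₗ ι = LinearMap.id) (p : MvPolynomial (Fin n) K) : subst ι (subst r p) = p := by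
  have : (subst ι).comp (subst r) = AlgHom.id K (MvPolynomial (Fin n) K) := by
    refine MvPolynomial.algHom_ext fun i => ?_
    rw [AlgHom.comp_apply, ← linPoly_proj, subst_linPoly, subst_linPoly, LinearMap.comp_assoc, hr]
    rfl
  exact AlgHom.congr_fun this p

/-- A derivation tangent to `ker α` restricts to this hyperplane. -/
lemma exists_restrict {α : (Fin m → K) →ₗ[K] K} {ι : (Fin n → K) →ₗ[K] (Fin m → K)}
    (hι : Function.Injective ι) (hr : LinearMap.range ι = LinearMap.ker α) {θ : Der K m}
    (hθ : subst ι (θ (linPoly α)) = 0) :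
    ∃ η : Der K n, ∀ f, η (linPoly (f ∘ₗ ι)) = subst ι (θ (linPoly f)) := by
  obtain ⟨r, hr'⟩ := ι.exists_leftInverse_of_injective (LinearMap.ker_eq_bot.2 hι)
  refine ⟨mkDerivation K fun j => subst ι (θ (linPoly (LinearMap.proj j ∘ₗ r))), fun f => ?_⟩
  have h1 : ∀ g : (Fin n → K) →ₗ[K] K,
      mkDerivation K (fun j => subst ι (θ (linPoly (LinearMap.proj j ∘ₗ r)))) (linPoly g) =
        subst ι (θ (linPoly (g ∘ₗ r))) := by
    intro g
    rw [← subst_linPoly, linPoly_eq_sum g]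
    simp only [map_sum, map_smul, Derivation.map_smul, mkDerivation_X]
    refine Finset.sum_congr rfl fun i _ => ?_
    rw [← linPoly_proj, subst_linPoly]
  rw [h1]
  obtain ⟨c, hc⟩ := exists_eq_smul_of_ker_le (f := α) (g := (f ∘ₗ ι) ∘ₗ r - f) (by
    rw [← hr]
    rintro _ ⟨y, rfl⟩
    have : r (ι y) = y := LinearMap.congr_fun hr' y
    simp [this])
  rw [sub_eq_iff_eq_add] at hc
  rw [hc, linPoly_add, linPoly_smul, map_add, map_add, Derivation.map_smul, map_smul, hθ]
  simp

lemma isRestriction_iff {A : Arrangement K (n + 1)} {H : Submodule K (Fin (n + 1) → K)}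
    {B : Arrangement K n} : IsRestriction A H B ↔
      ∃ ι : (Fin n → K) →ₗ[K] (Fin (n + 1) → K), Function.Injective ι ∧ LinearMap.range ι = H ∧
        B.hyperplanes = (A.hyperplanes.erase H).image (Submodule.comap ι) := by
  constructor
  · rintro ⟨e, he⟩
    refine ⟨H.subtype ∘ₗ e.symm.toLinearMap, ?_, ?_, ?_⟩
    · simpa using Subtype.val_injective.comp e.symm.injective
    · rw [LinearMap.range_comp]; simp
    · rw [he]
      congr 1
      ext1 X
      rw [Submodule.comap_comp, Submodule.map_equiv_eq_comap_symm]
  · rintro ⟨ι, hι, rfl, hB⟩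
    refine ⟨(LinearEquiv.ofInjective ι hι).symm, ?_⟩
    rw [hB]
    congr 1
    ext1 X
    rw [Submodule.map_equiv_eq_comap_symm]
    rfl

lemma ker_comp_eq_comap (f : (Fin m → K) →ₗ[K] K) (ι : (Fin n → K) →ₗ[K] (Fin m → K)) :
    LinearMap.ker (f ∘ₗ ι) = (LinearMap.ker f).comap ι := rfl

section Restriction

variable {A : Arrangement K (n + 1)} {α : (Fin (n + 1) → K) →ₗ[K] K} {B : Arrangement K n}
  {ι : (Fin n → K) →ₗ[K] (Fin (n + 1) → K)}

lemma mem_derSub_restrict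
    (hB : B.hyperplanes = (A.hyperplanes.erase (LinearMap.ker α)).image (Submodule.comap ι))
    {θ : Der K (n + 1)} (hθ : θ ∈ derSub (A.delete (LinearMap.ker α)))
    {η : Der K n} (hη : ∀ f, η (linPoly (f ∘ₗ ι)) = subst ι (θ (linPoly f))) : η ∈ derSub B := by
  intro g hg
  have hg0 := B.ne_zero hg
  rw [hB, Finset.mem_image] at hg
  obtain ⟨H, hH, hHg⟩ := hg
  obtain ⟨f, hf, rfl⟩ := A.isHyp H (Finset.mem_of_mem_erase hH)
  obtain ⟨c, rfl⟩ := exists_eq_smul_of_ker_le (f := f ∘ₗ ι) hHg.le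
  obtain ⟨q, hq⟩ := hθ f hH
  refine ⟨subst ι q, ?_⟩
  rw [linPoly_smul, Derivation.map_smul, hη, hq, map_mul, subst_linPoly, smul_mul_assoc]

lemma linPoly_isRelPrime {f g : (Fin n → K) →ₗ[K] K} (hf : f ≠ 0) (hg : g ≠ 0)
    (h : LinearMap.ker f ≠ LinearMap.ker g) : IsRelPrime (linPoly f) (linPoly g) :=
  (linPoly_prime hf).irreducible.isRelPrime_iff_not_dvd.2 fun h' =>
    h (ker_eq_of_linPoly_dvd hf hg h')

lemma pow_dvd_subst
    (hι : Function.Injective ι) (hr : LinearMap.range ι = LinearMap.ker α)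
    {θ : Der K (n + 1)} {β : (Fin n → K) →ₗ[K] K} (hβ : β ≠ 0)
    (s : Finset (Submodule K (Fin (n + 1) → K)))
    (hs : ∀ H ∈ s, ∃ f : (Fin (n + 1) → K) →ₗ[K] K, H = LinearMap.ker f ∧
      linPoly f ∣ θ (linPoly f) ∧ LinearMap.ker (f ∘ₗ ι) = LinearMap.ker β) :
    linPoly β ^ (s.card - 1) ∣ subst ι (θ (linPoly α)) := by
  obtain rfl | ⟨H₀, hH₀⟩ := s.eq_empty_or_nonempty
  · simp
  choose! f hfk hfd hfβ using hs
  have hf0 : ∀ H ∈ s, f H ≠ 0 := fun H hH h0 => by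
    have := hfβ H hH
    rw [h0, LinearMap.zero_comp, LinearMap.ker_zero] at this
    exact hβ (LinearMap.ker_eq_top.1 this.symm)
  have hz : subst ι (linPoly α) = 0 := (subst_eq_zero_iff hι hr _).2 dvd_rfl
  let W : ((Fin (n + 1) → K) →ₗ[K] K) → MvPolynomial (Fin (n + 1)) K := fun g =>
    linPoly g * θ (linPoly α) - linPoly α * θ (linPoly g)
  have hW : ∀ H ∈ s, linPoly (f H) ∣ W (f H₀) := by
    intro H hH
    obtain ⟨c, hc⟩ := exists_eq_smul_of_ker_le (f := f H ∘ₗ ι) (g := f H₀ ∘ₗ ι)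
      ((hfβ H hH).trans (hfβ H₀ hH₀).symm).le
    obtain ⟨c', hc'⟩ := exists_eq_smul_of_ker_le (f := α) (g := f H₀ - c • f H) (by
      rw [← hr]
      rintro _ ⟨y, rfl⟩
      simpa [sub_eq_zero] using LinearMap.congr_fun hc y)
    rw [sub_eq_iff_eq_add] at hc'
    have h1 : W (f H₀) = c • W (f H) := by
      simp only [W, hc', linPoly_add, linPoly_smul]
      rw [map_add, Derivation.map_smul, Derivation.map_smul]
      simp only [MvPolynomial.smul_eq_C_mul]
      ring
    rw [h1]
    exact dvd_smul_of_dvd c (dvd_sub (Dvd.intro _ rfl) ((hfd H hH).mul_left _))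
  have h1 : ∏ H ∈ s, linPoly (f H) ∣ W (f H₀) := by
    refine Finset.prod_dvd_of_isRelPrime (fun H hH H' hH' hne => ?_) hW
    refine linPoly_isRelPrime (hf0 H hH) (hf0 H' hH') fun h => hne ?_
    rw [hfk H hH, hfk H' hH', h]
  have h2 := map_dvd (subst ι) h1
  have h3 : linPoly β ^ s.card ∣ ∏ H ∈ s, subst ι (linPoly (f H)) := by
    rw [← Finset.prod_const]
    refine Finset.prod_dvd_prod_of_dvd _ _ fun H hH => ?_
    obtain ⟨c, hc⟩ := exists_eq_smul_of_ker_le (hfβ H hH).ge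
    rw [subst_linPoly, hc, linPoly_smul]
    exact dvd_smul_of_dvd c dvd_rfl
  rw [map_prod] at h2
  have h4 := h3.trans h2
  simp only [W, map_sub, map_mul, hz, zero_mul, sub_zero] at h4
  obtain ⟨c, hc⟩ := exists_eq_smul_of_ker_le (hfβ H₀ hH₀).le
  rw [hc] at hβ
  have h5 : linPoly β ^ s.card ∣ linPoly β * subst ι (θ (linPoly α)) := by
    rw [hc, linPoly_smul, ← subst_linPoly, smul_mul_assoc]
    rw [hc, linPoly_smul, ← subst_linPoly] at h4
    exact dvd_smul_of_dvd c h4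
  rw [← hc] at hβ
  have hcard : s.card = (s.card - 1) + 1 := (Nat.sub_add_cancel (Finset.card_pos.2 ⟨_, hH₀⟩)).symm
  rw [hcard, pow_succ'] at h5
  exact (mul_dvd_mul_iff_left (linPoly_prime hβ).ne_zero).1 h5

/-- The polynomial controlling the values at `α` of the derivations of the deletion. -/
lemma exists_control_poly
    (hι : Function.Injective ι) (hr : LinearMap.range ι = LinearMap.ker α)
    (hB : B.hyperplanes = (A.hyperplanes.erase (LinearMap.ker α)).image (Submodule.comap ι)) :
    ∃ (b : ℕ) (P : MvPolynomial (Fin n) K), P.IsHomogeneous b ∧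
    b + B.hyperplanes.card = (A.delete (LinearMap.ker α)).hyperplanes.card ∧
    ∀ θ ∈ derSub (A.delete (LinearMap.ker α)), P ∣ subst ι (θ (linPoly α)) := by
  choose! β hβ using B.isHyp
  let s : Submodule K (Fin n → K) → Finset (Submodule K (Fin (n + 1) → K)) := fun Y =>
    {H ∈ A.hyperplanes.erase (LinearMap.ker α) | H.comap ι = Y}
  refine ⟨∑ Y ∈ B.hyperplanes, 1 * ((s Y).card - 1),
    ∏ Y ∈ B.hyperplanes, linPoly (β Y) ^ ((s Y).card - 1),
    IsHomogeneous.prod _ _ _ fun Y _ => (linPoly_isHomogeneous _).pow _, ?_, fun θ hθ => ?_⟩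
  · have h1 : (A.delete (LinearMap.ker α)).hyperplanes.card = ∑ Y ∈ B.hyperplanes, (s Y).card :=
      Finset.card_eq_sum_card_fiberwise fun H hH => by
        rw [hB]; exact Finset.mem_image_of_mem _ hH
    rw [h1, Finset.card_eq_sum_ones, ← Finset.sum_add_distrib]
    refine Finset.sum_congr rfl fun Y hY => ?_
    rw [hB, Finset.mem_image] at hY
    obtain ⟨H, hH, rfl⟩ := hY
    have : 0 < (s (H.comap ι)).card := Finset.card_pos.2 ⟨H, Finset.mem_filter.2 ⟨hH, rfl⟩⟩
    omega
  · refine Finset.prod_dvd_of_isRelPrime (fun Y hY Y' hY' hne => ?_) fun Y hY => ?_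
    · refine (linPoly_isRelPrime (hβ Y hY).1 (hβ Y' hY').1 fun h => hne ?_).pow
      rw [(hβ Y hY).2, (hβ Y' hY').2, h]
    · refine pow_dvd_subst hι hr (hβ Y hY).1 _ fun H hH => ?_
      obtain ⟨hH, hHY⟩ := Finset.mem_filter.1 hH
      obtain ⟨f, hf, rfl⟩ := A.isHyp H (Finset.mem_of_mem_erase hH)
      exact ⟨f, rfl, hθ f hH, by rw [ker_comp_eq_comap, hHY, ← (hβ Y hY).2]⟩

lemma linearIndepOn_restrict
    (hα : LinearMap.ker α ∈ A.hyperplanes)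
    (hι : Function.Injective ι) (hr : LinearMap.range ι = LinearMap.ker α)
    {κ : Type*} [Fintype κ] {d : κ → ℕ} {w : κ → Der K (n + 1)}
    (h : IsHomBasis (A.delete (LinearMap.ker α)) d w) {t : Set κ} {η : κ → Der K n}
    (hη : ∀ i ∈ t, ∀ f, η i (linPoly (f ∘ₗ ι)) = subst ι (w i (linPoly f))) :
    LinearIndepOn (MvPolynomial (Fin n) K) η t := by
  obtain ⟨r, hr'⟩ := ι.exists_leftInverse_of_injective (LinearMap.ker_eq_bot.2 hι)
  rw [linearIndepOn_iff'']
  intro s g hs hg0 hg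
  let G : κ → MvPolynomial (Fin (n + 1)) K := fun i => subst r (g i)
  have hd : ∀ j, linPoly α ∣ (∑ i, G i • w i) (X j) := by
    intro j
    rw [← subst_eq_zero_iff hι hr, ← linPoly_proj, der_sum_apply, map_sum,
      ← Finset.sum_subset s.subset_univ fun i _ hi => by simp [G, hg0 i hi]]
    have h1 := congrArg (fun η : Der K n => η (linPoly (LinearMap.proj j ∘ₗ ι))) hg
    simp only [der_sum_apply] at h1
    refine (Finset.sum_congr rfl fun i hi => ?_).trans h1
    simp [G, hη i (hs hi), subst_leftInverse hr']
  choose q hq using hd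
  have h1 : ∑ i, G i • w i = linPoly α • (mkDerivation K q : Der K (n + 1)) :=
    derivation_ext fun j => by simp [hq j]
  have h2 : (mkDerivation K q : Der K (n + 1)) ∈ derSub (A.delete (LinearMap.ker α)) := by
    refine mem_derSub_of_smul_mem (A.ne_zero hα) (Finset.notMem_erase _ _) ?_
    rw [← h1, ← h.span_eq]
    exact Submodule.sum_mem _ fun i _ => Submodule.smul_mem _ _ (Submodule.subset_span ⟨i, rfl⟩)
  rw [← h.span_eq, Submodule.mem_span_range_iff_exists_fun] at h2
  obtain ⟨c, hc⟩ := h2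
  have h3 : ∑ i, (G i - linPoly α * c i) • w i = 0 := by
    refine (sum_sub_mul_smul w G c _).trans ?_
    rw [hc]
    exact sub_eq_zero.2 h1
  intro i _
  have h4 := Fintype.linearIndependent_iff.1 h.indep _ h3 i
  have h5 : linPoly α ∣ G i := ⟨c i, sub_eq_zero.1 h4⟩
  rw [← subst_eq_zero_iff hι hr] at h5
  simpa [G, subst_leftInverse hr'] using h5

end Restriction

lemma map_update_eq_cons {κ : Type*} [Fintype κ] (d : κ → ℕ) (i : κ) (b : ℕ) {e : Multiset ℕ}
    (h : Finset.univ.val.map d = d i ::ₘ e) :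
    Finset.univ.val.map (Function.update d i b) = b ::ₘ e := by
  have h1 : (Finset.univ : Finset κ).val = i ::ₘ (Finset.univ.erase i).val := by
    rw [Finset.erase_val, Multiset.cons_erase (Finset.mem_univ_val i)]
  rw [h1, Multiset.map_cons, Multiset.cons_inj_right] at h
  rw [h1, Multiset.map_cons, Function.update_self, ← h]
  congr 1
  refine Multiset.map_congr rfl fun j hj => ?_
  rw [Function.update_of_ne (Finset.ne_of_mem_erase hj)]

/-- Terao's addition theorem. -/
theorem HasExponents.addition {A : Arrangement K (n + 1)} {H : Submodule K (Fin (n + 1) → K)}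
    (hH : H ∈ A.hyperplanes) {B : Arrangement K n} (hB : IsRestriction A H B)
    {b : ℕ} {e : Multiset ℕ} (h' : HasExponents (A.delete H) (b ::ₘ e)) (h'' : HasExponents B e)
    (hb : b + B.hyperplanes.card = (A.delete H).hyperplanes.card) :
    HasExponents A ((b + 1) ::ₘ e) := by
  obtain ⟨α, hα0, rfl⟩ := A.isHyp H hH
  obtain ⟨ι, hι, hr, hB⟩ := isRestriction_iff.1 hB
  obtain ⟨r, hr'⟩ := ι.exists_leftInverse_of_injective (LinearMap.ker_eq_bot.2 hι)
  obtain ⟨k, d, w, hw, hd⟩ := h'.exists_isHomBasis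
  obtain ⟨l, c, v, hv, hc⟩ := h''.exists_isHomBasis
  obtain ⟨b', P, hP, hb', hPd⟩ := exists_control_poly hι hr hB
  obtain rfl : b' = b := by omega
  have hmem : ∀ i, w i ∈ derSub (A.delete (LinearMap.ker α)) := fun i =>
    hw.span_eq ▸ Submodule.subset_span ⟨i, rfl⟩
  have hhom : ∀ i, (subst ι (w i (linPoly α))).IsHomogeneous (d i) := fun i =>
    subst_isHomogeneous ι (hom_linPoly (hw.hom i) α)
  obtain ⟨i, hib, hi⟩ : ∃ i, d i ≤ b' ∧ subst ι (w i (linPoly α)) ≠ 0 := by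
    by_contra! hcon
    have hex := fun i hi => exists_restrict hι hr (hcon i hi)
    choose! η hη using hex
    have hind := linearIndepOn_restrict hH hι hr hw (t := {i | d i ≤ b'}) hη
    have hle := card_le_of_homogeneous (ι := {i // d i ≤ b'}) hv.hom (v := fun i => η i)
      (c := fun i => d i) (b := b') (fun i j => ?_) (fun i => i.2) hind fun i => ?_
    · rw [card_subtype_le_eq_countP, card_subtype_le_eq_countP, ← hd, ← hc] at hle
      simp at hle
    · have h1 := hη i i.2 (LinearMap.proj j ∘ₗ r)
      rw [LinearMap.comp_assoc, hr', LinearMap.comp_id, linPoly_proj] at h1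
      rw [h1]
      exact subst_isHomogeneous _ (hom_linPoly (hw.hom i) _)
    · rw [hv.span_eq]
      exact mem_derSub_restrict hB (hmem i) (hη i i.2)
  have hdiv : ∀ j, subst ι (w i (linPoly α)) ∣ subst ι (w j (linPoly α)) := by
    intro j
    obtain ⟨g, hg, hg1, hg2⟩ := exists_homogeneous_cofactor hP (hhom i) (hPd _ (hmem i))
    have hdi : d i = b' := by
      refine hib.antisymm (not_lt.1 fun hlt => hi ?_)
      rw [hg, hg2 hlt, zero_mul]
    have hg3 := hg1 hdi.ge
    rw [hdi, Nat.sub_self, ← totalDegree_zero_iff_isHomogeneous, totalDegree_eq_zero_iff_eq_C]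
      at hg3
    refine Dvd.dvd.trans ?_ (hPd _ (hmem j))
    refine ⟨C (coeff 0 g)⁻¹, ?_⟩
    have hne : coeff 0 g ≠ 0 := fun h0 => hi (by rw [hg, hg3, h0, C_0, zero_mul])
    rw [hg, hg3, coeff_C, if_pos rfl, mul_right_comm, ← C_mul, mul_inv_cancel₀ hne, C_1, one_mul]
  have hdi : d i = b' := by
    obtain ⟨g, hg, -, hg2⟩ := exists_homogeneous_cofactor hP (hhom i) (hPd _ (hmem i))
    refine hib.antisymm (not_lt.1 fun hlt => hi ?_)
    rw [hg, hg2 hlt, zero_mul]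
  have hG := fun j => exists_homogeneous_cofactor (hhom i) (hhom j) (hdiv j)
  choose G hGe hG1 hG2 using hG
  let f : Fin k → MvPolynomial (Fin (n + 1)) K := fun j => if j = i then 0 else subst r (G j)
  have hf : ∀ j l, (f j * w i (X l)).IsHomogeneous (d j) := by
    intro j l
    by_cases hj : j = i
    · simpa [f, hj] using isHomogeneous_zero _ _ _
    simp only [f, hj, if_false]
    obtain hlt | hge := lt_or_ge (d j) (d i)
    · rw [hG2 j hlt, map_zero, zero_mul]
      exact isHomogeneous_zero _ _ _
    · have := (subst_isHomogeneous r (hG1 j hge)).mul (hw.hom i l)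
      rwa [Nat.sub_add_cancel hge] at this
  have hw' := (hw.shear i (f := f) (by simp [f]) hf).scale hH i ?_ fun j hj => ?_
  · have := hw'.hasExponents
    rwa [map_update_eq_cons d i _ (e := e) (by rw [← hd, hdi]), hdi] at this
  · rw [← subst_eq_zero_iff hι hr]
    simpa [f] using hi
  · rw [← subst_eq_zero_iff hι hr]
    simp [f, hj, subst_leftInverse hr', sub_eq_zero]
    exact hGe j

end Addition

section Combinatorics

variable {K : Type*} [Field K] {K' : Type*} [Field K'] {m n : ℕ}

lemma Arrangement.isCoatom {A : Arrangement K n} {H : Submodule K (Fin n → K)}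
    (hH : H ∈ A.hyperplanes) : IsCoatom H := by
  obtain ⟨f, hf, rfl⟩ := A.isHyp H hH
  exact LinearMap.isCoatom_ker_of_surjective (LinearMap.surjective hf)

lemma Arrangement.eq_of_le {A : Arrangement K n} {H H' : Submodule K (Fin n → K)}
    (hH : H ∈ A.hyperplanes) (hH' : H' ∈ A.hyperplanes) (h : H ≤ H') : H = H' :=
  ((A.isCoatom hH).le_iff.1 h).resolve_left (A.isCoatom hH').1 |>.symm

/-- `φ` maps the hyperplanes of `A` bijectively to those of `B`, compatibly with the closure
operators of the underlying matroids. -/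
structure CombEquiv (A : Arrangement K m) (B : Arrangement K' n)
    (φ : Submodule K (Fin m → K) → Submodule K' (Fin n → K')) : Prop where
  bijOn : Set.BijOn φ A.hyperplanes B.hyperplanes
  inf_le_iff : ∀ s : Finset (Submodule K (Fin m → K)), s ⊆ A.hyperplanes →
    ∀ H ∈ A.hyperplanes, s.inf id ≤ H ↔ s.inf φ ≤ φ H

namespace CombEquiv

variable {A : Arrangement K m} {B : Arrangement K' n}
  {φ : Submodule K (Fin m → K) → Submodule K' (Fin n → K')}

lemma card_eq (h : CombEquiv A B φ) : A.hyperplanes.card = B.hyperplanes.card :=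
  Finset.card_bij (fun H _ => φ H) (fun _ hH => h.bijOn.mapsTo hH)
    (fun _ hH _ hH' e => h.bijOn.injOn hH hH' e) fun _ hG => by
      obtain ⟨H, hH, e⟩ := h.bijOn.surjOn hG
      exact ⟨H, hH, e⟩

lemma delete (h : CombEquiv A B φ) {H : Submodule K (Fin m → K)} (hH : H ∈ A.hyperplanes) :
    CombEquiv (A.delete H) (B.delete (φ H)) φ := by
  refine ⟨⟨fun X hX => ?_, h.bijOn.injOn.mono fun X hX => Finset.mem_of_mem_erase hX,
    fun Y hY => ?_⟩, fun s hs X hX => h.inf_le_iff s (hs.trans (Finset.erase_subset _ _)) X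
      (Finset.mem_of_mem_erase hX)⟩
  · obtain ⟨hne, hX⟩ := Finset.mem_erase.1 hX
    exact Finset.mem_erase.2 ⟨fun e => hne (h.bijOn.injOn hX hH e), h.bijOn.mapsTo hX⟩
  · obtain ⟨hne, hY⟩ := Finset.mem_erase.1 hY
    obtain ⟨X, hX, rfl⟩ := h.bijOn.surjOn hY
    exact ⟨X, Finset.mem_erase.2 ⟨fun e => hne (e ▸ rfl), hX⟩, rfl⟩

end CombEquiv

lemma inf_comap_le_comap_iff {κ : Type*} {ι : (Fin m → K) →ₗ[K] (Fin n → K)} (s : Finset κ)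
    (F : κ → Submodule K (Fin n → K)) (X : Submodule K (Fin n → K)) :
    (s.inf fun i => (F i).comap ι) ≤ X.comap ι ↔ LinearMap.range ι ⊓ s.inf F ≤ X := by
  rw [← Submodule.comap_finsetInf]
  constructor
  · rintro h _ ⟨⟨y, rfl⟩, hy⟩
    exact h hy
  · exact fun h y hy => h ⟨LinearMap.mem_range_self _ _, hy⟩

lemma CombEquiv.restrict {A : Arrangement K (m + 1)} {B : Arrangement K' (n + 1)}
    {φ : Submodule K (Fin (m + 1) → K) → Submodule K' (Fin (n + 1) → K')} (h : CombEquiv A B φ)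
    {H : Submodule K (Fin (m + 1) → K)} (hH : H ∈ A.hyperplanes) {A' : Arrangement K m}
    {B' : Arrangement K' n} (hA : IsRestriction A H A') (hB : IsRestriction B (φ H) B') :
    ∃ ψ, CombEquiv A' B' ψ := by
  obtain ⟨ι, -, hr, hA⟩ := isRestriction_iff.1 hA
  obtain ⟨κ, -, hr', hB⟩ := isRestriction_iff.1 hB
  have hd := h.delete hH
  have key : ∀ s ⊆ A.hyperplanes.erase H, ∀ X ∈ A.hyperplanes,
      (s.inf fun Y => Y.comap ι) ≤ X.comap ι ↔
        (s.inf fun Y => (φ Y).comap κ) ≤ (φ X).comap κ := by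
    intro s hs X hX
    have h1 := h.inf_le_iff (insert H s)
      (Finset.insert_subset hH (hs.trans (Finset.erase_subset _ _))) X hX
    rw [Finset.inf_insert, Finset.inf_insert] at h1
    rw [inf_comap_le_comap_iff s φ, hr', ← h1, ← hr]
    exact inf_comap_le_comap_iff s id X
  have hle : ∀ X ∈ A.hyperplanes.erase H, ∀ Y ∈ A.hyperplanes.erase H,
      X.comap ι ≤ Y.comap ι ↔ (φ X).comap κ ≤ (φ Y).comap κ := fun X hX Y hY => by
    simpa using key {X} (Finset.singleton_subset_iff.2 hX) Y (Finset.mem_of_mem_erase hY)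
  have heq : ∀ X ∈ A.hyperplanes.erase H, ∀ Y ∈ A.hyperplanes.erase H,
      X.comap ι = Y.comap ι ↔ (φ X).comap κ = (φ Y).comap κ := fun X hX Y hY => by
    rw [le_antisymm_iff, le_antisymm_iff, hle X hX Y hY, hle Y hY X hX]
  have hex : ∀ Z ∈ A'.hyperplanes, ∃ X ∈ A.hyperplanes.erase H, X.comap ι = Z := fun Z hZ => by
    rwa [hA, Finset.mem_image] at hZ
  choose! c hc hcZ using hex
  have hmem : ∀ X ∈ A.hyperplanes.erase H, X.comap ι ∈ A'.hyperplanes := fun X hX =>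
    hA ▸ Finset.mem_image_of_mem _ hX
  refine ⟨fun Z => (φ (c Z)).comap κ, ⟨fun Z hZ => ?_, fun Z hZ W hW e => ?_, fun W hW => ?_⟩,
    fun s hs Z hZ => ?_⟩
  · rw [hB]
    exact Finset.mem_image_of_mem _ (hd.bijOn.mapsTo (hc Z hZ))
  · rw [← hcZ Z hZ, ← hcZ W hW]
    exact (heq _ (hc Z hZ) _ (hc W hW)).2 e
  · rw [hB, Finset.mem_coe, Finset.mem_image] at hW
    obtain ⟨Y, hY, rfl⟩ := hW
    obtain ⟨X, hX, rfl⟩ := hd.bijOn.surjOn hY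
    exact ⟨_, hmem X hX, (heq _ (hc _ (hmem X hX)) _ hX).1 (hcZ _ (hmem X hX))⟩
  · have h1 := key (s.image c) (Finset.image_subset_iff.2 fun W hW => hc W (hs hW)) (c Z)
      (Finset.mem_of_mem_erase (hc Z hZ))
    rw [Finset.inf_image, Finset.inf_image, hcZ Z hZ] at h1
    have h2 : s.inf ((fun Y => Submodule.comap ι Y) ∘ c) = s.inf id :=
      Finset.inf_congr rfl fun W hW => hcZ W (hs hW)
    rw [h2] at h1
    exact h1

lemma exists_isRestriction {A : Arrangement K (n + 1)} {H : Submodule K (Fin (n + 1) → K)}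
    (hH : H ∈ A.hyperplanes) : ∃ B, IsRestriction A H B := by
  obtain ⟨α, hα, rfl⟩ := A.isHyp H hH
  obtain ⟨ι, hι, hr⟩ := exists_parametrization hα
  refine ⟨⟨(A.hyperplanes.erase (LinearMap.ker α)).image (Submodule.comap ι), fun X hX => ?_⟩,
    isRestriction_iff.2 ⟨ι, hι, hr, rfl⟩⟩
  obtain ⟨Y, hY, rfl⟩ := Finset.mem_image.1 hX
  obtain ⟨hne, hY⟩ := Finset.mem_erase.1 hY
  obtain ⟨f, hf, rfl⟩ := A.isHyp Y hY
  refine ⟨f ∘ₗ ι, fun h0 => hne (A.eq_of_le hH hY ?_).symm, rfl⟩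
  rw [← hr]
  rintro _ ⟨y, rfl⟩
  exact LinearMap.congr_fun h0 y

section Lattice

variable (A : Arrangement K m)

lemma Arrangement.inf_mem_lattice {s : Finset (Submodule K (Fin m → K))}
    (hs : s ⊆ A.hyperplanes) : s.inf id ∈ A.lattice := ⟨s, hs, rfl⟩

lemma Arrangement.mem_lattice {H : Submodule K (Fin m → K)} (hH : H ∈ A.hyperplanes) :
    H ∈ A.lattice := ⟨{H}, by simpa using hH, by simp⟩

lemma Arrangement.top_mem_lattice : ⊤ ∈ A.lattice := ⟨∅, by simp, by simp⟩

lemma Arrangement.isMax_lattice_iff (X : A.lattice) : IsMax X ↔ X.1 = ⊤ := by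
  refine ⟨fun h => top_le_iff.1 ?_, fun h Y _ => ?_⟩
  · exact h (b := ⟨⊤, A.top_mem_lattice⟩) (show X.1 ≤ ⊤ from le_top)
  · exact (show Y.1 ≤ X.1 from h ▸ le_top)

/-- The hyperplanes are the coatoms of the lattice (ordered by inclusion). -/
lemma Arrangement.mem_hyperplanes_iff (X : A.lattice) :
    X.1 ∈ A.hyperplanes ↔ ¬ IsMax X ∧ ∀ Y, X < Y → IsMax Y := by
  constructor
  · intro h
    refine ⟨fun hX => (A.isCoatom h).1 ((A.isMax_lattice_iff X).1 hX), fun Y hY => ?_⟩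
    exact (A.isMax_lattice_iff Y).2 ((A.isCoatom h).2 Y.1 hY)
  · rintro ⟨h1, h2⟩
    obtain ⟨X, s, hs, rfl⟩ := X
    obtain rfl | ⟨H, hH⟩ := s.eq_empty_or_nonempty
    · exact absurd ((A.isMax_lattice_iff _).2 (by simp)) h1
    · have hHA : H ∈ A.hyperplanes := hs hH
      have hle : s.inf id ≤ H := Finset.inf_le (f := id) hH
      obtain h | h := hle.eq_or_lt
      · change s.inf id ∈ _
        rwa [h]
      · have := h2 ⟨H, A.mem_lattice hHA⟩ h
        rw [A.isMax_lattice_iff] at this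
        exact absurd this (A.isCoatom hHA).1

end Lattice

lemma exists_combEquiv {A : Arrangement K m} {B : Arrangement K' n} (Φ : A.lattice ≃o B.lattice) :
    ∃ φ, CombEquiv A B φ := by
  let φ : Submodule K (Fin m → K) → Submodule K' (Fin n → K') := fun X =>
    if h : X ∈ A.lattice then (Φ ⟨X, h⟩).1 else ⊤
  have hφ : ∀ X : A.lattice, φ X.1 = (Φ X).1 := fun X => dif_pos X.2
  have hmem : ∀ X : A.lattice, X.1 ∈ A.hyperplanes ↔ (Φ X).1 ∈ B.hyperplanes := by
    intro X
    rw [A.mem_hyperplanes_iff, B.mem_hyperplanes_iff, Φ.isMax_apply, Φ.surjective.forall]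
    simp only [Φ.isMax_apply, Φ.lt_iff_lt]
  have hinf : ∀ s : Finset (Submodule K (Fin m → K)), (hs : s ⊆ A.hyperplanes) →
      s.inf φ = (Φ ⟨s.inf id, A.inf_mem_lattice hs⟩).1 := by
    intro s hs
    have hsφ : s.image φ ⊆ B.hyperplanes := Finset.image_subset_iff.2 fun H hH => by
      have := (hmem ⟨H, A.mem_lattice (hs hH)⟩).1 (hs hH)
      rwa [← hφ] at this
    refine le_antisymm ?_ (Finset.le_inf fun H hH => ?_)
    · let Y : B.lattice := ⟨(s.image φ).inf id, B.inf_mem_lattice hsφ⟩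
      have hY : Y.1 = s.inf φ := Finset.inf_image _ _ _
      have h1 : Φ.symm Y ≤ ⟨s.inf id, A.inf_mem_lattice hs⟩ := by
        change (Φ.symm Y).1 ≤ s.inf id
        refine Finset.le_inf fun H hH => ?_
        have h2 : Φ.symm Y ≤ ⟨H, A.mem_lattice (hs hH)⟩ := by
          rw [OrderIso.symm_apply_le]
          change Y.1 ≤ _
          rw [hY, ← hφ]
          exact Finset.inf_le hH
        exact h2
      rw [OrderIso.symm_apply_le] at h1
      rw [← hY]
      exact h1
    · rw [show φ H = _ from hφ ⟨H, A.mem_lattice (hs hH)⟩]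
      exact Φ.le_iff_le.2 (show s.inf id ≤ H from Finset.inf_le hH)
  refine ⟨φ, ⟨fun H hH => ?_, fun H hH H' hH' e => ?_, fun G hG => ?_⟩, fun s hs H hH => ?_⟩
  · have := (hmem ⟨H, A.mem_lattice hH⟩).1 hH
    rwa [← hφ] at this
  · rw [show φ H = _ from hφ ⟨H, A.mem_lattice hH⟩,
      show φ H' = _ from hφ ⟨H', A.mem_lattice hH'⟩] at e
    exact congrArg Subtype.val (Φ.injective (Subtype.ext e))
  · obtain ⟨X, hX⟩ := Φ.surjective ⟨G, B.mem_lattice hG⟩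
    refine ⟨X.1, (hmem X).2 (by rw [hX]; exact hG), ?_⟩
    rw [hφ, hX]
  · rw [hinf s hs, show φ H = _ from hφ ⟨H, A.mem_lattice hH⟩]
    exact (Φ.le_iff_le (x := ⟨s.inf id, A.inf_mem_lattice hs⟩)
      (y := ⟨H, A.mem_lattice hH⟩)).symm

end Combinatorics

section InductivelyFree

variable {K : Type*} [Field K] {K' : Type*} [Field K'] {m n : ℕ}

lemma exists_eq_cons {e' e'' : Multiset ℕ} (h : e'' ≤ e')
    (hc : Multiset.card e' = Multiset.card e'' + 1) : ∃ b, e' = b ::ₘ e'' := by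
  obtain ⟨t, rfl⟩ := Multiset.le_iff_exists_add.1 h
  rw [Multiset.card_add, add_right_inj, Multiset.card_eq_one] at hc
  obtain ⟨b, rfl⟩ := hc
  exact ⟨b, by rw [add_comm, Multiset.singleton_add]⟩

/-- Inductively free arrangements are free. -/
lemma InductivelyFree.exists_hasExponents {A : Arrangement K n} (h : InductivelyFree K A) :
    ∃ e, HasExponents A e ∧ Multiset.card e = n ∧ e.sum = A.hyperplanes.card := by
  induction h with
  | empty n => exact ⟨_, hasExponents_empty K n, by simp, by simp [emptyArr]⟩
  | @add n A H hH B hB e' e'' _ _ h3 h4 h5 ih1 ih2 =>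
    obtain ⟨f', hf', hc', hs'⟩ := ih1
    obtain ⟨f'', hf'', hc'', hs''⟩ := ih2
    obtain rfl := h3.unique hf'
    obtain rfl := h4.unique hf''
    obtain ⟨b, rfl⟩ := exists_eq_cons h5 (by rw [hc', hc''])
    rw [Multiset.sum_cons] at hs'
    refine ⟨_, h3.addition hH hB h4 (by omega), by simp [hc''], ?_⟩
    have : (A.delete H).hyperplanes.card + 1 = A.hyperplanes.card := Finset.card_erase_add_one hH
    rw [Multiset.sum_cons]
    omega

/-- Inductive freeness and, up to zeros, the exponents are invariant under combinatorial
equivalence. -/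
lemma InductivelyFree.of_combEquiv {A : Arrangement K m} (h : InductivelyFree K A) :
    ∃ e, HasExponents A e ∧ ∀ {n : ℕ} (B : Arrangement K' n) (φ), CombEquiv A B φ →
      InductivelyFree K' B ∧ ∃ f, HasExponents B f ∧
        e + Multiset.replicate n 0 = f + Multiset.replicate m 0 := by
  induction h with
  | empty m =>
    refine ⟨_, hasExponents_empty K m, fun {n} B φ hφ => ?_⟩
    obtain rfl : B = emptyArr K' n := by
      obtain ⟨s, hs⟩ := B
      have h0 := hφ.card_eq
      obtain rfl : s = ∅ := Finset.card_eq_zero.1 h0.symm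
      rfl
    exact ⟨.empty n, _, hasExponents_empty K' n, add_comm _ _⟩
  | @add m A H hH A₁ hA₁ e' e'' h1 h2 h3 h4 h5 ih1 ih2 =>
    obtain ⟨f', hf', hc', hs'⟩ := h1.exists_hasExponents
    obtain ⟨f'', hf'', hc'', hs''⟩ := h2.exists_hasExponents
    obtain rfl := h3.unique hf'
    obtain rfl := h4.unique hf''
    obtain ⟨b, rfl⟩ := exists_eq_cons h5 (by rw [hc', hc''])
    rw [Multiset.sum_cons] at hs'
    refine ⟨_, h3.addition hH hA₁ h4 (by omega), fun {n} B φ hφ => ?_⟩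
    have hG := hφ.bijOn.mapsTo hH
    obtain _ | n := n
    · obtain ⟨g, hg, -⟩ := B.isHyp _ hG
      exact absurd (Subsingleton.elim g 0) hg
    obtain ⟨B₁, hB₁⟩ := exists_isRestriction hG
    obtain ⟨ψ, hψ⟩ := hφ.restrict hH hA₁ hB₁
    obtain ⟨g', hg', ih1⟩ := ih1
    obtain ⟨g'', hg'', ih2⟩ := ih2
    obtain rfl := h3.unique hg'
    obtain rfl := h4.unique hg''
    obtain ⟨hB', f', hf', he'⟩ := ih1 _ _ (hφ.delete hH)
    obtain ⟨hB'', f'', hf'', he''⟩ := ih2 _ _ hψ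
    have hff : f' = b ::ₘ f'' := by
      have : f' + Multiset.replicate m 0 = b ::ₘ f'' + Multiset.replicate m 0 := by
        rw [Multiset.replicate_succ, Multiset.replicate_succ, Multiset.add_cons, Multiset.add_cons,
          Multiset.cons_inj_right] at he'
        rw [← he', Multiset.cons_add, Multiset.cons_add, he'']
      exact add_right_cancel this
    subst hff
    refine ⟨.add B (φ H) hG B₁ hB₁ _ _ hB' hB'' hf' hf'' (Multiset.le_cons_self _ _), _,
      hf'.addition hG hB₁ hf'' ?_, ?_⟩
    · rw [← (hφ.delete hH).card_eq, ← hψ.card_eq]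
      omega
    · rw [Multiset.replicate_succ, Multiset.replicate_succ, Multiset.add_cons, Multiset.add_cons,
        Multiset.cons_add, Multiset.cons_add, he'']

end InductivelyFree
end Arrgt

open Arrgt in
/-- Inductive freeness is a combinatorial property of the intersection lattice:
if two arrangements have isomorphic intersection lattices, then one is inductively
free iff the other is. -/
theorem inductivelyFree_combinatorial
    {K₁ K₂ : Type*} [Field K₁] [Field K₂] {m n : ℕ}
    (A : Arrangement K₁ m) (B : Arrangement K₂ n)
    (iso : Nonempty ((A.lattice : Set (Submodule K₁ (Fin m → K₁))) ≃o
      (B.lattice : Set (Submodule K₂ (Fin n → K₂))))) :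
    InductivelyFree K₁ A ↔ InductivelyFree K₂ B := by
  obtain ⟨Φ⟩ := iso
  constructor
  · intro h
    obtain ⟨φ, hφ⟩ := exists_combEquiv Φ
    obtain ⟨_, _, h⟩ := h.of_combEquiv (K' := K₂)
    exact (h B φ hφ).1
  · intro h
    obtain ⟨φ, hφ⟩ := exists_combEquiv Φ.symm
    obtain ⟨_, _, h⟩ := h.of_combEquiv (K' := K₁)
    exact (h A φ hφ).1
end

section
/- For the 27-hyperplane arrangement A in ℚ(ζ)³ (the union of the H₃ reflection arrangement with the W-orbit of (1,-ζ²,0)^⊥), the characteristic polynomial factors as χ_A(t) = (t-1)(t-11)(t-15). -/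
open Module Matrix
open scoped Classical

namespace Arrgt

section Perp

variable {K : Type*} [Field K]

lemma mem_perp {n : ℕ} {v x : Fin n → K} : x ∈ perp v ↔ v ⬝ᵥ x = 0 := by
  simp [perp, lf, dotProduct]

lemma perp_vecMul {n : ℕ} (v : Fin n → K) (M : Matrix (Fin n) (Fin n) K) :
    perp (v ᵥ* M) = (perp v).comap M.mulVecLin := by
  ext x
  simp [mem_perp, dotProduct_mulVec]

lemma finrank_perp {v : Fin 3 → K} (hv : v ≠ 0) : finrank K (perp v) = 2 := by
  have := Module.Dual.finrank_ker_add_one_of_ne_zero (lf_ne_zero hv)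
  simp only [finrank_fin_fun] at this
  unfold perp
  omega

lemma perp_eq_perp_of_cross_eq_zero {u v : Fin 3 → K} (hu : u ≠ 0) (hv : v ≠ 0)
    (h : u ⨯₃ v = 0) : perp u = perp v := by
  obtain ⟨a, rfl⟩ : ∃ a : K, a • u = v := by
    by_contra! hne
    exact crossProduct_ne_zero_iff_linearIndependent.2
      ((LinearIndependent.pair_iff' hu).2 hne) h
  have ha : a ≠ 0 := by rintro rfl; simp at hv
  ext x
  simp [mem_perp, ha]

lemma perp_inf_perp {u v : Fin 3 → K} (h : u ⨯₃ v ≠ 0) :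
    perp u ⊓ perp v = Submodule.span K {u ⨯₃ v} := by
  ext x
  rw [Submodule.mem_inf, mem_perp, mem_perp, Submodule.mem_span_singleton]
  constructor
  · rintro ⟨hu, hv⟩
    by_contra! hne
    refine crossProduct_ne_zero_iff_linearIndependent.2
      ((LinearIndependent.pair_iff' h).2 hne) ?_
    rw [cross_cross_eq_smul_sub_smul, hu, hv]
    simp
  · rintro ⟨a, rfl⟩
    simp [dot_self_cross, dot_cross_self]

lemma finrank_perp_inf_perp {u v : Fin 3 → K} (h : u ⨯₃ v ≠ 0) :
    finrank K ↥(perp u ⊓ perp v) = 1 := by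
  rw [perp_inf_perp h, finrank_span_singleton h]

lemma perp_inf_perp_le_iff {u v w : Fin 3 → K} (h : u ⨯₃ v ≠ 0) :
    perp u ⊓ perp v ≤ perp w ↔ w ⬝ᵥ u ⨯₃ v = 0 := by
  rw [perp_inf_perp h, Submodule.span_singleton_le_iff_mem, mem_perp]

end Perp

section CharPoly

variable {K : Type*} [Field K] {n : ℕ} {H : Fin n → Submodule K (Fin 3 → K)}
  {LA : Finset (Submodule K (Fin 3 → K))}

/-- The one-dimensional members of a finite set of subspaces. -/
noncomputable def linesOf (LA : Finset (Submodule K (Fin 3 → K))) :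
    Finset (Submodule K (Fin 3 → K)) :=
  {X ∈ LA | finrank K X = 1}

lemma mem_linesOf {X : Submodule K (Fin 3 → K)} :
    X ∈ linesOf LA ↔ X ∈ LA ∧ finrank K X = 1 := by
  simp [linesOf]

lemma injective_of_finrank_inf (h2 : ∀ i, finrank K (H i) = 2)
    (h1 : ∀ i j, i ≠ j → finrank K ↥(H i ⊓ H j) = 1) : Function.Injective H := by
  intro i j hij
  by_contra hne
  have := h1 i j hne
  rw [hij, inf_idem, h2] at this
  omega

lemma exists_eq_inf_of_mem_setLattice
    (h1 : ∀ i j, i ≠ j → finrank K ↥(H i ⊓ H j) = 1)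
    {X : Submodule K (Fin 3 → K)} (hX : X ∈ setLattice (Set.range H)) :
    X = ⊤ ∨ X ∈ Set.range H ∨ (finrank K X = 1 ∧ ∃ i j, i < j ∧ X = H i ⊓ H j) ∨ X = ⊥ := by
  obtain ⟨s, hs, rfl⟩ := hX
  by_cases hfin : s.inf id = ⊥
  · simp [hfin]
  by_cases htop : s.inf id = ⊤
  · simp [htop]
  obtain ⟨Y, hY, -⟩ : ∃ Y ∈ s, Y ≠ ⊤ := by
    by_contra! hall
    exact htop ((Finset.inf_eq_top_iff _ _).2 hall)
  obtain ⟨i, rfl⟩ := hs hY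
  by_cases hi : s.inf id = H i
  · exact Or.inr (Or.inl ⟨i, hi.symm⟩)
  obtain ⟨Z, hZ, hiZ⟩ : ∃ Z ∈ s, ¬ H i ≤ Z := by
    by_contra! hall
    exact hi (le_antisymm (Finset.inf_le (f := id) hY) (Finset.le_inf hall))
  obtain ⟨j, rfl⟩ := hs hZ
  have hij : i ≠ j := by rintro rfl; exact hiZ le_rfl
  have hle : s.inf id ≤ H i ⊓ H j :=
    le_inf (Finset.inf_le (f := id) hY) (Finset.inf_le (f := id) hZ)
  have hpos : finrank K ↥(s.inf id) ≠ 0 := fun h => hfin (Submodule.finrank_eq_zero.1 h)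
  have hrank : finrank K ↥(s.inf id) = finrank K ↥(H i ⊓ H j) := by
    have := Submodule.finrank_mono hle
    have := h1 i j hij
    omega
  have heq := Submodule.eq_of_le_of_finrank_eq hle hrank
  refine Or.inr (Or.inr (Or.inl ⟨hrank.trans (h1 i j hij), ?_⟩))
  rcases lt_or_gt_of_ne hij with h | h
  · exact ⟨i, j, h, heq⟩
  · exact ⟨j, i, h, heq.trans (inf_comm _ _)⟩

lemma inf_mem_setLattice (i j : Fin n) : H i ⊓ H j ∈ setLattice (Set.range H) :=
  ⟨{H i, H j}, by simp [Set.insert_subset_iff], by simp⟩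

lemma sum_setLattice {M : Type*} [AddCommMonoid M] (h2 : ∀ i, finrank K (H i) = 2)
    (h1 : ∀ i j, i ≠ j → finrank K ↥(H i ⊓ H j) = 1)
    (h0 : ∃ i j k, H i ⊓ H j ⊓ H k = ⊥) (hLA : ↑LA = setLattice (Set.range H))
    (f : Submodule K (Fin 3 → K) → M) :
    ∑ X ∈ LA, f X =
      f ⊤ + ∑ i, f (H i) + ∑ X ∈ linesOf LA, f X + f ⊥ := by
  have hmem {X} : X ∈ LA ↔ X ∈ setLattice (Set.range H) := by rw [← hLA, Finset.mem_coe]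
  have htop : finrank K (⊤ : Submodule K (Fin 3 → K)) = 3 := by simp
  have hbot : finrank K (⊥ : Submodule K (Fin 3 → K)) = 0 := by simp
  have hLA' : LA = {⊤} ∪ Finset.univ.image H ∪ linesOf LA ∪ {⊥} := by
    ext X
    simp only [Finset.mem_union, Finset.mem_singleton, Finset.mem_image, Finset.mem_univ,
      true_and, mem_linesOf]
    constructor
    · intro hX
      rcases exists_eq_inf_of_mem_setLattice h1 (hmem.1 hX) with h | h | h | h
      · simp [h]
      · exact Or.inl (Or.inl (Or.inr h))
      · exact Or.inl (Or.inr ⟨hX, h.1⟩)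
      · simp [h]
    · rintro (((rfl | ⟨i, rfl⟩) | h) | rfl)
      · exact hmem.2 ⟨∅, by simp, by simp⟩
      · simpa using hmem.2 (inf_mem_setLattice (H := H) i i)
      · exact h.1
      · obtain ⟨i, j, k, h⟩ := h0
        exact hmem.2 ⟨{H i, H j, H k}, by simp [Set.insert_subset_iff], by
          simp [← h, inf_assoc]⟩
  conv_lhs => rw [hLA']
  rw [Finset.sum_union, Finset.sum_union, Finset.sum_union, Finset.sum_singleton,
    Finset.sum_singleton, Finset.sum_image (injective_of_finrank_inf h2 h1).injOn]
  · rw [Finset.disjoint_left]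
    simp only [Finset.mem_singleton, Finset.mem_image, Finset.mem_univ, true_and]
    rintro X rfl ⟨i, hi⟩
    have := h2 i
    rw [hi] at this
    omega
  · rw [Finset.disjoint_left]
    simp only [Finset.mem_union, Finset.mem_singleton, Finset.mem_image, Finset.mem_univ,
      true_and, mem_linesOf]
    rintro X (rfl | ⟨i, rfl⟩) ⟨-, h⟩
    · omega
    · have := h2 i
      omega
  · rw [Finset.disjoint_right]
    simp only [Finset.mem_union, Finset.mem_singleton, Finset.mem_image, Finset.mem_univ,
      true_and, mem_linesOf]
    rintro X rfl ((h | ⟨i, hi⟩) | ⟨-, h⟩)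
    · rw [h] at hbot
      omega
    · have := h2 i
      rw [hi] at this
      omega
    · omega

/-- Each rank-two flat `X` is counted once for each hyperplane through it other than the first. -/
lemma sum_card_sub_one (h1 : ∀ i j, i ≠ j → finrank K ↥(H i ⊓ H j) = 1)
    (h2 : ∀ i, finrank K (H i) = 2) (hLA : ↑LA = setLattice (Set.range H)) :
    ∑ X ∈ linesOf LA, (((Finset.univ.filter fun i => X ≤ H i).card : ℤ) - 1) =
      (Finset.univ.filter fun p : Fin n × Fin n =>
        p.1 < p.2 ∧ ∀ l < p.1, ¬ H p.1 ⊓ H p.2 ≤ H l).card := by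
  have hmem {X} : X ∈ LA ↔ X ∈ setLattice (Set.range H) := by rw [← hLA, Finset.mem_coe]
  rw [Finset.card_eq_sum_card_fiberwise (f := fun p : Fin n × Fin n => H p.1 ⊓ H p.2)
    (t := linesOf LA)]
  · push_cast
    refine Finset.sum_congr rfl fun X hX => ?_
    rw [mem_linesOf] at hX
    have hbt : X ≠ ⊤ ∧ X ∉ Set.range H ∧ X ≠ ⊥ := by
      refine ⟨?_, ?_, ?_⟩
      · rintro rfl
        simp at hX
      · rintro ⟨i, rfl⟩
        have := h2 i
        omega
      · rintro rfl
        simp at hX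
    obtain ⟨i, j, hij, rfl⟩ : ∃ i j, i < j ∧ X = H i ⊓ H j := by
      have := exists_eq_inf_of_mem_setLattice h1 (hmem.1 hX.1)
      tauto
    set S := Finset.univ.filter fun l => H i ⊓ H j ≤ H l with hS
    have hmemS {l} : l ∈ S ↔ H i ⊓ H j ≤ H l := by simp [hS]
    have hne : S.Nonempty := ⟨i, hmemS.2 inf_le_left⟩
    have hmin := S.min'_mem hne
    have hflat {k l} (hk : k ∈ S) (hl : l ∈ S) (hkl : k ≠ l) : H k ⊓ H l = H i ⊓ H j :=
      (Submodule.eq_of_le_of_finrank_eq (le_inf (hmemS.1 hk) (hmemS.1 hl))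
        (hX.2.trans (h1 k l hkl).symm)).symm
    have hcard : (S.card : ℤ) - 1 = (S.erase (S.min' hne)).card := by
      rw [Finset.card_erase_of_mem hmin, Nat.cast_sub (Finset.card_pos.2 hne), Nat.cast_one]
    rw [hcard, Nat.cast_inj]
    refine Finset.card_bij' (fun k _ => (S.min' hne, k)) (fun p _ => p.2) ?_ ?_ ?_ ?_
    · intro k hk
      rw [Finset.mem_erase] at hk
      have heq := hflat hmin hk.2 hk.1.symm
      simp only [Finset.mem_filter, Finset.mem_univ, true_and]
      refine ⟨⟨lt_of_le_of_ne (S.min'_le k hk.2) hk.1.symm, fun l hl hle => ?_⟩, heq⟩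
      rw [heq] at hle
      exact absurd (S.min'_le l (hmemS.2 hle)) (not_le.2 hl)
    · rintro ⟨a, b⟩ hp
      simp only [Finset.mem_filter, Finset.mem_univ, true_and] at hp
      obtain ⟨⟨hab, -⟩, heq⟩ := hp
      have ha : a ∈ S := hmemS.2 (heq ▸ inf_le_left)
      have hb : b ∈ S := hmemS.2 (heq ▸ inf_le_right)
      exact Finset.mem_erase.2 ⟨((S.min'_le a ha).trans_lt hab).ne', hb⟩
    · intro k _
      rfl
    · rintro ⟨a, b⟩ hp
      simp only [Finset.mem_filter, Finset.mem_univ, true_and] at hp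
      obtain ⟨⟨hab, hfirst⟩, heq⟩ := hp
      have ha : a ∈ S := hmemS.2 (heq ▸ inf_le_left)
      refine Prod.ext (le_antisymm (S.min'_le a ha) (not_lt.1 fun hlt => ?_)) rfl
      exact hfirst _ hlt (heq ▸ hmemS.1 hmin)
  · intro p hp
    simp only [Finset.coe_filter, Finset.mem_univ, true_and, Set.mem_ofPred_eq, Finset.mem_coe, mem_linesOf] at hp ⊢
    exact ⟨hmem.2 (inf_mem_setLattice _ _), h1 _ _ hp.1.ne⟩

/-- The characteristic polynomial of an essential rank-three arrangement, whose linear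
coefficient counts the pairs of hyperplanes containing no broken circuit. -/
theorem charPoly_rank_three (h2 : ∀ i, finrank K (H i) = 2)
    (h1 : ∀ i j, i ≠ j → finrank K ↥(H i ⊓ H j) = 1)
    (h0 : ∃ i j k, H i ⊓ H j ⊓ H k = ⊥) (hLA : ↑LA = setLattice (Set.range H))
    (μ : Submodule K (Fin 3 → K) → ℤ) (hμtop : μ ⊤ = 1)
    (hμ : ∀ X ∈ LA, X ≠ ⊤ → (∑ Y ∈ LA, if X ≤ Y then μ Y else 0) = 0)
    {c : ℤ} (hc : ((Finset.univ.filter fun p : Fin n × Fin n =>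
      p.1 < p.2 ∧ ∀ l < p.1, ¬ H p.1 ⊓ H p.2 ≤ H l).card : ℤ) = c)
    {R : Type*} [CommRing R] (t : R) :
    ∑ X ∈ LA, (μ X : R) * t ^ finrank K X = t ^ 3 - n * t ^ 2 + c * t - (1 - n + c : ℤ) := by
  have hinj := injective_of_finrank_inf h2 h1
  have hmem {X} : X ∈ LA ↔ X ∈ setLattice (Set.range H) := by rw [← hLA, Finset.mem_coe]
  have hsum {X} (hX : X ∈ setLattice (Set.range H)) (hne : X ≠ ⊤) :=
    (sum_setLattice h2 h1 h0 hLA _).symm.trans (hμ X (hmem.2 hX) hne)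
  have hH i : μ (H i) = -1 := by
    have hrank := h2 i
    have hbot : ¬ H i ≤ ⊥ := by
      rw [le_bot_iff]
      intro h
      rw [h, finrank_bot] at hrank
      omega
    have hle j : H i ≤ H j ↔ i = j :=
      ⟨fun h => hinj (Submodule.eq_of_le_of_finrank_eq h ((h2 i).trans (h2 j).symm)),
        fun h => h ▸ le_rfl⟩
    have hline : ∑ Y ∈ linesOf LA, (if H i ≤ Y then μ Y else 0) = 0 := by
      refine Finset.sum_eq_zero fun Y hY => if_neg fun h => ?_
      have := Submodule.finrank_mono h
      have := (mem_linesOf.1 hY).2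
      omega
    have := hsum (X := H i) (by simpa using inf_mem_setLattice (H := H) i i)
      (by
      intro h
      rw [h, finrank_top, finrank_fin_fun] at hrank
      omega)
    simp only [le_top, if_true, hμtop, hle, Finset.sum_ite_eq, Finset.mem_univ, hline, hbot,
      if_false] at this
    omega
  have hL X (hX : X ∈ LA) (hX1 : finrank K X = 1) :
      μ X = ((Finset.univ.filter fun i => X ≤ H i).card : ℤ) - 1 := by
    have hbot : ¬ X ≤ ⊥ := by
      rw [le_bot_iff]
      rintro rfl
      simp at hX1
    have hline : ∑ Y ∈ linesOf LA, (if X ≤ Y then μ Y else 0) = μ X := by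
      rw [Finset.sum_eq_single X]
      · simp
      · intro Y hY hne
        refine if_neg fun h => hne ?_
        exact (Submodule.eq_of_le_of_finrank_eq h
          (hX1.trans (mem_linesOf.1 hY).2.symm)).symm
      · intro h
        exact absurd (mem_linesOf.2 ⟨hX, hX1⟩) h
    have := hsum (hmem.1 hX) (by rintro rfl; simp at hX1)
    simp only [le_top, if_true, hμtop, hH, hline, hbot, if_false, ← Finset.sum_filter,
      Finset.sum_const, smul_neg, nsmul_eq_mul, mul_one] at this
    omega
  have hLsum : ∑ X ∈ linesOf LA, μ X = c := by
    rw [← hc, ← sum_card_sub_one h1 h2 hLA]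
    exact Finset.sum_congr rfl fun X hX =>
      hL X (mem_linesOf.1 hX).1 (mem_linesOf.1 hX).2
  have hbot : μ ⊥ = -(1 - n + c : ℤ) := by
    obtain ⟨i, j, k, h⟩ := h0
    have := hsum (X := ⊥) ⟨{H i, H j, H k}, by simp [Set.insert_subset_iff], by
      simp [← h, inf_assoc]⟩ bot_ne_top
    simp only [bot_le, if_true, hμtop, hH, hLsum, Finset.sum_const, Finset.card_univ,
      Fintype.card_fin, smul_neg, nsmul_eq_mul, mul_one] at this
    linarith
  have hLpoly : ∑ X ∈ linesOf LA, (μ X : R) * t ^ finrank K X = c * t := by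
    rw [← hLsum, Int.cast_sum, Finset.sum_mul]
    exact Finset.sum_congr rfl fun X hX => by rw [(mem_linesOf.1 hX).2, pow_one]
  rw [sum_setLattice h2 h1 h0 hLA, hLpoly, hbot, hμtop]
  simp only [hH, h2, finrank_top, finrank_bot, finrank_fin_fun, Finset.sum_const,
    Finset.card_univ, Fintype.card_fin]
  push_cast
  simp only [nsmul_eq_mul]
  ring

end CharPoly

end Arrgt

namespace Arrgt

section Action

variable {K : Type*} [Field K] {n m : ℕ} {H : Fin m → Submodule K (Fin n → K)}

lemma comap_mem_range_of_mem_closure {s : Set (GL (Fin n) K)} (hs : ∀ g ∈ s, g * g = 1)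
    (h : ∀ g ∈ s, ∀ i,
      (H i).comap (g : Matrix (Fin n) (Fin n) K).mulVecLin ∈ Set.range H)
    {g : GL (Fin n) K} (hg : g ∈ Subgroup.closure s) (i : Fin m) :
    (H i).comap (g : Matrix (Fin n) (Fin n) K).mulVecLin ∈ Set.range H := by
  have hmul (x y : GL (Fin n) K)
      (hx : (H i).comap (x : Matrix (Fin n) (Fin n) K).mulVecLin ∈ Set.range H) (hy : y ∈ s) :
      (H i).comap ((x * y : GL (Fin n) K) : Matrix (Fin n) (Fin n) K).mulVecLin ∈
        Set.range H := by
    obtain ⟨j, hj⟩ := hx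
    rw [Units.val_mul, mulVecLin_mul, Submodule.comap_comp, ← hj]
    exact h y hy j
  induction hg using Subgroup.closure_induction_right with
  | one => exact ⟨i, by simp [mulVecLin_one]⟩
  | mul_right x _ y hy hx => exact hmul x y hx hy
  | mul_inv_cancel x _ y hy hx =>
    rw [inv_eq_of_mul_eq_one_left (hs y hy)]
    exact hmul x y hx hy

end Action

/-- The element `a + bζ + cζ² + dζ³` of `ℤ[ζ]`, for `ζ` a primitive fifth root of unity. -/
structure CycInt where
  a : ℤ
  b : ℤ
  c : ℤ
  d : ℤ

namespace CycInt

instance : Add CycInt := ⟨fun x y => ⟨x.a + y.a, x.b + y.b, x.c + y.c, x.d + y.d⟩⟩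

instance : Sub CycInt := ⟨fun x y => ⟨x.a - y.a, x.b - y.b, x.c - y.c, x.d - y.d⟩⟩

instance : Mul CycInt :=
  ⟨fun x y =>
    let e := x.b * y.d + x.c * y.c + x.d * y.b
    ⟨x.a * y.a + x.c * y.d + x.d * y.c - e,
     x.a * y.b + x.b * y.a + x.d * y.d - e,
     x.a * y.c + x.b * y.b + x.c * y.a - e,
     x.a * y.d + x.b * y.c + x.c * y.b + x.d * y.a - e⟩⟩

def isZero (x : CycInt) : Bool := x.a == 0 && x.b == 0 && x.c == 0 && x.d == 0

/-- The value in `ℂ` of an element of `ℤ[ζ]`. -/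
noncomputable def eval (ζ : ℂ) (x : CycInt) : ℂ := x.a + x.b * ζ + x.c * ζ ^ 2 + x.d * ζ ^ 3

variable {ζ : ℂ}

lemma eval_add (x y : CycInt) : eval ζ (x + y) = eval ζ x + eval ζ y := by
  change eval ζ ⟨_, _, _, _⟩ = _
  simp only [eval]
  push_cast
  ring

lemma eval_sub (x y : CycInt) : eval ζ (x - y) = eval ζ x - eval ζ y := by
  change eval ζ ⟨_, _, _, _⟩ = _
  simp only [eval]
  push_cast
  ring

lemma one_add_pows_eq_zero (hζ : IsPrimitiveRoot ζ 5) :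
    1 + ζ + ζ ^ 2 + ζ ^ 3 + ζ ^ 4 = 0 := by
  simpa [Finset.sum_range_succ] using hζ.geom_sum_eq_zero (by norm_num)

lemma eval_mul (hζ : IsPrimitiveRoot ζ 5) (x y : CycInt) :
    eval ζ (x * y) = eval ζ x * eval ζ y := by
  change eval ζ ⟨_, _, _, _⟩ = _
  simp only [eval]
  push_cast
  linear_combination
    (-(x.b * y.d + x.c * y.c + x.d * y.b : ℂ)) * one_add_pows_eq_zero hζ
      - (x.c * y.d + x.d * y.c + x.d * y.d * ζ : ℂ) * hζ.pow_eq_one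

lemma isZero_iff {x : CycInt} : x.isZero = true ↔ x.a = 0 ∧ x.b = 0 ∧ x.c = 0 ∧ x.d = 0 := by
  simp [isZero, and_assoc]

open Polynomial in
lemma eval_eq_zero_iff (hζ : IsPrimitiveRoot ζ 5) {x : CycInt} :
    eval ζ x = 0 ↔ x.isZero = true := by
  rw [isZero_iff]
  constructor
  · intro h
    set p : ℤ[X] := C x.a + C x.b * X + C x.c * X ^ 2 + C x.d * X ^ 3 with hp
    have hroot : aeval ζ p = 0 := by simpa [hp, eval] using h
    have hdvd : cyclotomic 5 ℤ ∣ p := by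
      rw [cyclotomic_eq_minpoly hζ (by norm_num)]
      exact minpoly.isIntegrallyClosed_dvd (hζ.isIntegral (by norm_num)) hroot
    have hp0 : p = 0 := by
      refine eq_zero_of_dvd_of_natDegree_lt hdvd ?_
      have : p.natDegree ≤ 3 := by rw [hp]; compute_degree
      rw [natDegree_cyclotomic, Nat.totient_prime (by norm_num)]
      omega
    have hcoeff k : p.coeff k = 0 := by rw [hp0, coeff_zero]
    have h0 := hcoeff 0
    have h1 := hcoeff 1
    have h2 := hcoeff 2
    have h3 := hcoeff 3
    norm_num [hp, coeff_C_mul, coeff_C, coeff_X, coeff_X_pow, -eq_intCast] at h0 h1 h2 h3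
    exact ⟨h0, h1, h2, h3⟩
  · rintro ⟨ha, hb, hc, hd⟩
    simp [eval, ha, hb, hc, hd]

def dot (u v : Fin 3 → CycInt) : CycInt := u 0 * v 0 + u 1 * v 1 + u 2 * v 2

def cross (u v : Fin 3 → CycInt) : Fin 3 → CycInt :=
  ![u 1 * v 2 - u 2 * v 1, u 2 * v 0 - u 0 * v 2, u 0 * v 1 - u 1 * v 0]

def vecMul (v : Fin 3 → CycInt) (M : Fin 3 → Fin 3 → CycInt) : Fin 3 → CycInt :=
  fun j => dot v fun i => M i j

def isZeroVec (v : Fin 3 → CycInt) : Bool := (v 0).isZero && (v 1).isZero && (v 2).isZero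

noncomputable def evalVec (ζ : ℂ) (v : Fin 3 → CycInt) : Fin 3 → ℂ := fun i => eval ζ (v i)

noncomputable def evalMat (ζ : ℂ) (M : Fin 3 → Fin 3 → CycInt) : Matrix (Fin 3) (Fin 3) ℂ :=
  Matrix.of fun i j => eval ζ (M i j)

lemma eval_dot (hζ : IsPrimitiveRoot ζ 5) (u v : Fin 3 → CycInt) :
    eval ζ (dot u v) = evalVec ζ u ⬝ᵥ evalVec ζ v := by
  simp [dot, evalVec, eval_add, eval_mul hζ, vec3_dotProduct]

lemma evalVec_cross (hζ : IsPrimitiveRoot ζ 5) (u v : Fin 3 → CycInt) :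
    evalVec ζ (cross u v) = evalVec ζ u ⨯₃ evalVec ζ v := by
  ext i
  fin_cases i <;> simp [cross, evalVec, eval_sub, eval_mul hζ, cross_apply]

lemma evalVec_vecMul (hζ : IsPrimitiveRoot ζ 5) (v : Fin 3 → CycInt)
    (M : Fin 3 → Fin 3 → CycInt) :
    evalVec ζ (vecMul v M) = evalVec ζ v ᵥ* evalMat ζ M := by
  ext j
  exact eval_dot hζ _ _

lemma evalVec_eq_zero_iff (hζ : IsPrimitiveRoot ζ 5) {v : Fin 3 → CycInt} :
    evalVec ζ v = 0 ↔ isZeroVec v = true := by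
  simp [funext_iff, Fin.forall_fin_succ, evalVec, eval_eq_zero_iff hζ, isZeroVec, and_assoc]

lemma evalVec_ne_zero_iff (hζ : IsPrimitiveRoot ζ 5) {v : Fin 3 → CycInt} :
    evalVec ζ v ≠ 0 ↔ isZeroVec v = false := by
  rw [ne_eq, evalVec_eq_zero_iff hζ, Bool.not_eq_true]

end CycInt

namespace H3A

open CycInt

/-- The three generating reflections, acting on row vectors from the right. -/
def generator : Fin 3 → Fin 3 → Fin 3 → CycInt :=
  ![![![⟨1, 0, 0, 0⟩, ⟨0, 0, 0, 0⟩, ⟨0, 0, 0, 0⟩],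
      ![⟨0, 0, 0, 0⟩, ⟨1, 0, 0, 0⟩, ⟨1, 0, 0, 0⟩],
      ![⟨0, 0, 0, 0⟩, ⟨0, 0, 0, 0⟩, ⟨-1, 0, 0, 0⟩]],
    ![![⟨-1, 0, 0, 0⟩, ⟨0, 0, 0, 0⟩, ⟨0, 0, 0, 0⟩],
      ![⟨0, 0, -1, -1⟩, ⟨1, 0, 0, 0⟩, ⟨0, 0, 0, 0⟩],
      ![⟨0, 0, 0, 0⟩, ⟨0, 0, 0, 0⟩, ⟨1, 0, 0, 0⟩]],
    ![![⟨1, 0, 0, 0⟩, ⟨0, 0, -1, -1⟩, ⟨0, 0, 0, 0⟩],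
      ![⟨0, 0, 0, 0⟩, ⟨-1, 0, 0, 0⟩, ⟨0, 0, 0, 0⟩],
      ![⟨0, 0, 0, 0⟩, ⟨1, 0, 0, 0⟩, ⟨1, 0, 0, 0⟩]]]

/-- Normals of the 15 reflection hyperplanes, followed by those of the 12 hyperplanes in the
orbit of `(1, -ζ², 0)^⊥`. -/
def normal : Fin 27 → Fin 3 → CycInt :=
  ![![⟨1, 0, 0, 0⟩, ⟨0, 0, 0, 0⟩, ⟨0, 0, 0, 0⟩],
    ![⟨1, 0, 0, 0⟩, ⟨0, 0, -1, -1⟩, ⟨0, 0, 0, 0⟩],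
    ![⟨1, 0, 0, 0⟩, ⟨0, 0, -1, -1⟩, ⟨0, 0, -1, -1⟩],
    ![⟨0, 0, -1, -1⟩, ⟨0, 0, -1, -1⟩, ⟨0, 0, 0, 0⟩],
    ![⟨0, 0, -1, -1⟩, ⟨0, 0, -1, -1⟩, ⟨0, 0, -1, -1⟩],
    ![⟨0, 0, -1, -1⟩, ⟨1, 0, 0, 0⟩, ⟨0, 0, 0, 0⟩],
    ![⟨0, 0, -1, -1⟩, ⟨1, 0, -1, -1⟩, ⟨0, 0, -1, -1⟩],
    ![⟨0, 0, -1, -1⟩, ⟨1, 0, 0, 0⟩, ⟨1, 0, 0, 0⟩],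
    ![⟨0, 0, 0, 0⟩, ⟨1, 0, 0, 0⟩, ⟨0, 0, 0, 0⟩],
    ![⟨0, 0, -1, -1⟩, ⟨1, 0, -1, -1⟩, ⟨1, 0, 0, 0⟩],
    ![⟨1, 0, -1, -1⟩, ⟨1, 0, -1, -1⟩, ⟨0, 0, -1, -1⟩],
    ![⟨0, 0, 0, 0⟩, ⟨1, 0, 0, 0⟩, ⟨1, 0, 0, 0⟩],
    ![⟨1, 0, -1, -1⟩, ⟨1, 0, -1, -1⟩, ⟨1, 0, 0, 0⟩],
    ![⟨1, 0, -1, -1⟩, ⟨0, 0, -2, -2⟩, ⟨0, 0, -1, -1⟩],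
    ![⟨0, 0, 0, 0⟩, ⟨0, 0, 0, 0⟩, ⟨1, 0, 0, 0⟩],
    ![⟨1, 0, 0, 0⟩, ⟨0, 0, -1, 0⟩, ⟨0, 0, 0, 0⟩],
    ![⟨1, 0, 0, 0⟩, ⟨0, 0, -1, 0⟩, ⟨0, 0, -1, 0⟩],
    ![⟨-1, -1, -1, -1⟩, ⟨0, 0, -1, 0⟩, ⟨0, 0, 0, 0⟩],
    ![⟨-1, -1, -1, -1⟩, ⟨0, 0, -1, 0⟩, ⟨0, 0, -1, 0⟩],
    ![⟨1, 0, 0, 0⟩, ⟨0, 0, -1, -1⟩, ⟨0, 0, -1, 0⟩],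
    ![⟨-1, -1, -1, -1⟩, ⟨0, -1, -1, 0⟩, ⟨0, 0, -1, 0⟩],
    ![⟨0, 0, -1, -1⟩, ⟨0, 0, -1, -1⟩, ⟨0, 0, -1, 0⟩],
    ![⟨0, -1, -1, 0⟩, ⟨0, -1, -1, 0⟩, ⟨0, 0, -1, 0⟩],
    ![⟨0, 0, -1, -1⟩, ⟨1, 0, -1, 0⟩, ⟨0, 0, -1, 0⟩],
    ![⟨0, -1, -1, 0⟩, ⟨-1, -1, -2, -1⟩, ⟨0, 0, -1, 0⟩],
    ![⟨0, 0, -1, -1⟩, ⟨1, 0, -1, 0⟩, ⟨1, 0, 0, 0⟩],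
    ![⟨0, -1, -1, -1⟩, ⟨1, 0, -1, 0⟩, ⟨0, 0, -1, 0⟩]]

set_option maxRecDepth 10000 in
lemma cross_normal : ∀ i j, i < j → isZeroVec (cross (normal i) (normal j)) = false := by
  decide +kernel

lemma isZeroVec_normal : ∀ i, isZeroVec (normal i) = false := by
  decide +kernel

lemma isZeroVec_vecMul_normal :
    ∀ i s, isZeroVec (vecMul (normal i) (generator s)) = false := by
  decide +kernel

lemma exists_cross_vecMul_normal :
    ∀ i s, ∃ j, isZeroVec (cross (vecMul (normal i) (generator s)) (normal j)) = true := by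
  decide +kernel

lemma exists_lt_cross_vecMul_normal : ∀ i, (i = 0 ∨ i = 8 ∨ i = 14 ∨ i = 15) ∨
    ∃ j, j < i ∧ ∃ s,
      isZeroVec (cross (vecMul (normal j) (generator s)) (normal i)) = true := by
  decide +kernel

set_option maxRecDepth 10000 in
lemma card_pairs_normal : (Finset.univ.filter fun p : Fin 27 × Fin 27 => p.1 < p.2 ∧
    ∀ l < p.1, (dot (normal l) (cross (normal p.1) (normal p.2))).isZero = false).card
      = 191 := by
  decide +kernel

noncomputable def plane (ζ : ℂ) (i : Fin 27) : Submodule ℂ (Fin 3 → ℂ) :=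
  perp (evalVec ζ (normal i))

variable {ζ : ℂ}

lemma evalVec_normal_zero : evalVec ζ (normal 0) = Pi.single 0 1 := by
  ext i
  fin_cases i <;> simp [evalVec, normal, eval]

lemma evalVec_normal_eight : evalVec ζ (normal 8) = Pi.single 1 1 := by
  ext i
  fin_cases i <;> simp [evalVec, normal, eval]

lemma evalVec_normal_fourteen : evalVec ζ (normal 14) = Pi.single 2 1 := by
  ext i
  fin_cases i <;> simp [evalVec, normal, eval]

lemma evalVec_normal_fifteen : evalVec ζ (normal 15) = ![1, -ζ ^ 2, 0] := by
  ext i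
  fin_cases i <;> simp [evalVec, normal, eval]

lemma cross_evalVec_normal (hζ : IsPrimitiveRoot ζ 5) {i j : Fin 27} (hij : i ≠ j) :
    evalVec ζ (normal i) ⨯₃ evalVec ζ (normal j) ≠ 0 := by
  rcases lt_or_gt_of_ne hij with h | h
  · rw [← evalVec_cross hζ, evalVec_ne_zero_iff hζ]
    exact cross_normal i j h
  · rw [← cross_anticomm, neg_ne_zero, ← evalVec_cross hζ, evalVec_ne_zero_iff hζ]
    exact cross_normal j i h

lemma finrank_plane (hζ : IsPrimitiveRoot ζ 5) (i : Fin 27) : finrank ℂ (plane ζ i) = 2 :=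
  finrank_perp ((evalVec_ne_zero_iff hζ).2 (isZeroVec_normal i))

lemma finrank_plane_inf (hζ : IsPrimitiveRoot ζ 5) (i j : Fin 27) (hij : i ≠ j) :
    finrank ℂ ↥(plane ζ i ⊓ plane ζ j) = 1 :=
  finrank_perp_inf_perp (cross_evalVec_normal hζ hij)

lemma plane_inf_le_iff (hζ : IsPrimitiveRoot ζ 5) {i j l : Fin 27} (hij : i ≠ j) :
    plane ζ i ⊓ plane ζ j ≤ plane ζ l ↔
      (dot (normal l) (cross (normal i) (normal j))).isZero = true := by
  rw [← eval_eq_zero_iff hζ, eval_dot hζ, evalVec_cross hζ]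
  exact perp_inf_perp_le_iff (cross_evalVec_normal hζ hij)

lemma plane_inf_plane_inf_plane : plane ζ 0 ⊓ plane ζ 8 ⊓ plane ζ 14 = ⊥ := by
  rw [eq_bot_iff]
  intro x
  simp only [plane, evalVec_normal_zero, evalVec_normal_eight, evalVec_normal_fourteen,
    Submodule.mem_inf, mem_perp, single_dotProduct, one_mul, Submodule.mem_bot]
  rintro ⟨⟨h0, h1⟩, h2⟩
  ext i
  fin_cases i <;> assumption

lemma comap_plane_eq (hζ : IsPrimitiveRoot ζ 5) {i j s}
    (h : isZeroVec (cross (vecMul (normal i) (generator s)) (normal j)) = true) :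
    (plane ζ i).comap (evalMat ζ (generator s)).mulVecLin = plane ζ j := by
  rw [plane, ← perp_vecMul, ← evalVec_vecMul hζ]
  refine perp_eq_perp_of_cross_eq_zero
    ((evalVec_ne_zero_iff hζ).2 (isZeroVec_vecMul_normal i s))
    ((evalVec_ne_zero_iff hζ).2 (isZeroVec_normal j)) ?_
  rw [← evalVec_cross hζ, evalVec_eq_zero_iff hζ, h]

lemma comap_plane_mem_range (hζ : IsPrimitiveRoot ζ 5) (i : Fin 27) (s : Fin 3) :
    (plane ζ i).comap (evalMat ζ (generator s)).mulVecLin ∈ Set.range (plane ζ) := by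
  obtain ⟨j, hj⟩ := exists_cross_vecMul_normal i s
  exact ⟨j, (comap_plane_eq hζ hj).symm⟩

lemma evalMat_generator_zero :
    evalMat ζ (generator 0) = !![1, 0, 0; 0, 1, 1; 0, 0, -1] := by
  ext i j
  fin_cases i <;> fin_cases j <;> simp [evalMat, generator, eval]

lemma evalMat_generator_one :
    evalMat ζ (generator 1) = !![-1, 0, 0; -ζ ^ 2 - ζ ^ 3, 1, 0; 0, 0, 1] := by
  ext i j
  fin_cases i <;> fin_cases j <;> simp [evalMat, generator, eval, sub_eq_add_neg]

lemma evalMat_generator_two :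
    evalMat ζ (generator 2) = !![1, -ζ ^ 2 - ζ ^ 3, 0; 0, -1, 0; 0, 1, 1] := by
  ext i j
  fin_cases i <;> fin_cases j <;> simp [evalMat, generator, eval, sub_eq_add_neg]

lemma evalMat_generator_mul_self (s : Fin 3) :
    evalMat ζ (generator s) * evalMat ζ (generator s) = 1 := by
  fin_cases s
  · change evalMat ζ (generator 0) * evalMat ζ (generator 0) = 1
    rw [evalMat_generator_zero]
    ext i j
    fin_cases i <;> fin_cases j <;> simp [Matrix.mul_apply, Fin.sum_univ_three]
  · change evalMat ζ (generator 1) * evalMat ζ (generator 1) = 1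
    rw [evalMat_generator_one]
    ext i j
    fin_cases i <;> fin_cases j <;> simp [Matrix.mul_apply, Fin.sum_univ_three]
    ring
  · change evalMat ζ (generator 2) * evalMat ζ (generator 2) = 1
    rw [evalMat_generator_two]
    ext i j
    fin_cases i <;> fin_cases j <;> simp [Matrix.mul_apply, Fin.sum_univ_three]
    ring

/-- The hyperplanes orthogonal to the two orbits are exactly the listed ones. -/
lemma perp_image_orbits (hζ : IsPrimitiveRoot ζ 5) {g : Fin 3 → GL (Fin 3) ℂ}
    (hg : ∀ s, (g s : Matrix (Fin 3) (Fin 3) ℂ) = evalMat ζ (generator s)) :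
    perp '' ({w | ∃ x ∈ Subgroup.closure (Set.range g), ∃ i : Fin 3,
          w = Pi.single i 1 ᵥ* (x : Matrix (Fin 3) (Fin 3) ℂ)} ∪
        {w | ∃ x ∈ Subgroup.closure (Set.range g),
          w = ![1, -ζ ^ 2, 0] ᵥ* (x : Matrix (Fin 3) (Fin 3) ℂ)}) =
      Set.range (plane ζ) := by
  have hbase {i : Fin 27} {v} (hv : evalVec ζ (normal i) = v) {x : GL (Fin 3) ℂ}
      (hx : x ∈ Subgroup.closure (Set.range g)) :
      perp (v ᵥ* (x : Matrix (Fin 3) (Fin 3) ℂ)) ∈ Set.range (plane ζ) := by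
    rw [perp_vecMul, ← hv]
    refine comap_mem_range_of_mem_closure (H := plane ζ) ?_ ?_ hx i
    · rintro _ ⟨s, rfl⟩
      ext1
      rw [Units.val_mul, hg, evalMat_generator_mul_self, Units.val_one]
    · rintro _ ⟨s, rfl⟩ j
      rw [hg]
      exact comap_plane_mem_range hζ j s
  apply Set.Subset.antisymm
  · rintro _ ⟨w, ⟨x, hx, i, rfl⟩ | ⟨x, hx, rfl⟩, rfl⟩
    · fin_cases i
      · exact hbase evalVec_normal_zero hx
      · exact hbase evalVec_normal_eight hx
      · exact hbase evalVec_normal_fourteen hx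
    · exact hbase evalVec_normal_fifteen hx
  · rintro _ ⟨i, rfl⟩
    induction i using WellFoundedLT.induction with
    | ind i ih =>
    rcases exists_lt_cross_vecMul_normal i with (rfl | rfl | rfl | rfl) | ⟨j, hji, s, hs⟩
    · exact ⟨_, Or.inl ⟨1, one_mem _, 0, rfl⟩, by simp [plane, evalVec_normal_zero]⟩
    · exact ⟨_, Or.inl ⟨1, one_mem _, 1, rfl⟩, by simp [plane, evalVec_normal_eight]⟩
    · exact ⟨_, Or.inl ⟨1, one_mem _, 2, rfl⟩, by simp [plane, evalVec_normal_fourteen]⟩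
    · exact ⟨_, Or.inr ⟨1, one_mem _, rfl⟩, by simp [plane, evalVec_normal_fifteen]⟩
    · obtain ⟨w, hw, hwj⟩ := ih j hji
      refine ⟨w ᵥ* (g s : Matrix (Fin 3) (Fin 3) ℂ), ?_, ?_⟩
      · have hgs := Subgroup.subset_closure (Set.mem_range_self (f := g) s)
        rcases hw with ⟨x, hx, k, rfl⟩ | ⟨x, hx, rfl⟩
        · exact Or.inl ⟨x * g s, mul_mem hx hgs, k, by rw [vecMul_vecMul, Units.val_mul]⟩
        · exact Or.inr ⟨x * g s, mul_mem hx hgs, by rw [vecMul_vecMul, Units.val_mul]⟩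
      · rw [perp_vecMul, hwj, hg, comap_plane_eq hζ hs]

lemma card_pairs_plane (hζ : IsPrimitiveRoot ζ 5) :
    (Finset.univ.filter fun p : Fin 27 × Fin 27 =>
      p.1 < p.2 ∧ ∀ l < p.1, ¬ plane ζ p.1 ⊓ plane ζ p.2 ≤ plane ζ l).card = 191 := by
  rw [← card_pairs_normal]
  congr 1
  ext p
  simp only [Finset.mem_filter, Finset.mem_univ, true_and]
  refine and_congr_right fun hp => forall₂_congr fun l _ => ?_
  rw [plane_inf_le_iff hζ hp.ne, Bool.not_eq_true]

end H3A

end Arrgt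

open Arrgt in
/-- The characteristic polynomial of the 27-hyperplane arrangement `𝓐` (defined by the
Möbius function `μ = μ(V, -)` of its intersection lattice) factors as
`(t-1)(t-11)(t-15)`. -/
theorem H3A_charPoly
    (ζ : ℂ) (hζ : IsPrimitiveRoot ζ 5)
    (g1 g2 g3 : GL (Fin 3) ℂ)
    (hg1 : (g1 : Matrix (Fin 3) (Fin 3) ℂ) = !![1, 0, 0; 0, 1, 1; 0, 0, -1])
    (hg2 : (g2 : Matrix (Fin 3) (Fin 3) ℂ) = !![-1, 0, 0; -ζ^2 - ζ^3, 1, 0; 0, 0, 1])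
    (hg3 : (g3 : Matrix (Fin 3) (Fin 3) ℂ) = !![1, -ζ^2 - ζ^3, 0; 0, -1, 0; 0, 1, 1])
    (W : Subgroup (GL (Fin 3) ℂ)) (hW : W = Subgroup.closure {g1, g2, g3})
    (R : Set (Fin 3 → ℂ))
    (hR : R = {w | ∃ g ∈ W, ∃ i : Fin 3,
          w = Matrix.vecMul (Pi.single i 1) (g : Matrix (Fin 3) (Fin 3) ℂ)} ∪
        {w | ∃ g ∈ W, w = Matrix.vecMul ![1, -ζ^2, 0] (g : Matrix (Fin 3) (Fin 3) ℂ)})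
    (𝓐 : Set (Submodule ℂ (Fin 3 → ℂ))) (h𝓐 : 𝓐 = Arrgt.perp '' R)
    (LA : Finset (Submodule ℂ (Fin 3 → ℂ))) (hLA : ↑LA = setLattice 𝓐)
    (μ : Submodule ℂ (Fin 3 → ℂ) → ℤ) (hμtop : μ ⊤ = 1)
    (hμ : ∀ X ∈ LA, X ≠ ⊤ → (∑ Y ∈ LA, if X ≤ Y then μ Y else 0) = 0) :
    ∀ t : ℂ, (∑ X ∈ LA, (μ X : ℂ) * t ^ (Module.finrank ℂ X)) =
      (t - 1) * (t - 11) * (t - 15) := by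
  have hg : ∀ s, ((![g1, g2, g3] s : GL (Fin 3) ℂ) : Matrix (Fin 3) (Fin 3) ℂ) =
      CycInt.evalMat ζ (H3A.generator s) := by
    intro s
    fin_cases s
    · exact hg1.trans H3A.evalMat_generator_zero.symm
    · exact hg2.trans H3A.evalMat_generator_one.symm
    · exact hg3.trans H3A.evalMat_generator_two.symm
  have hrange : Set.range ![g1, g2, g3] = {g1, g2, g3} := by
    ext x
    simp [eq_comm]
    tauto
  have hplanes := H3A.perp_image_orbits hζ hg
  rw [hrange, ← hW, ← hR, ← h𝓐] at hplanes
  rw [hplanes] at hLA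
  intro t
  rw [charPoly_rank_three (H3A.finrank_plane hζ) (H3A.finrank_plane_inf hζ)
    ⟨0, 8, 14, H3A.plane_inf_plane_inf_plane⟩ hLA μ hμtop hμ
    (congrArg Nat.cast (H3A.card_pairs_plane hζ))]
  push_cast
  ring
end

section
/- For the 27-hyperplane arrangement A in ℚ(ζ)³ (the H₃ reflection arrangement together with the orbit of (1,-ζ²,0)^⊥), every hyperplane H ∈ A satisfies |A^H| ∈ {10, 11}; precisely 15 hyperplanes have |A^H| = 10 and 12 hyperplanes have |A^H| = 11. -/
open Module Matrix
open scoped Classical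

namespace Arrgt

section Perp

variable {K : Type*} [Field K]

lemma perp_eq_perp_iff {u v : Fin 3 → K} (hu : u ≠ 0) (hv : v ≠ 0) :
    perp u = perp v ↔ u ⨯₃ v = 0 := by
  have key : ∀ {u v : Fin 3 → K}, u ≠ 0 → u ⨯₃ v = 0 → perp u ≤ perp v := by
    intro u v hu h x hx
    rw [mem_perp] at hx ⊢
    obtain ⟨k, hk⟩ := Function.ne_iff.mp hu
    have h0 := congrFun h 0
    have h1 := congrFun h 1
    have h2 := congrFun h 2
    simp only [cross_apply, vec3_dotProduct, Pi.zero_apply, cons_val] at *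
    refine (mul_eq_zero.mp (?_ : u k * _ = 0)).resolve_left hk
    fin_cases k <;> simp only [Fin.zero_eta, Fin.mk_one, Fin.reduceFinMk]
    · linear_combination v 0 * hx + x 1 * h2 - x 2 * h1
    · linear_combination v 1 * hx - x 0 * h2 + x 2 * h0
    · linear_combination v 2 * hx + x 0 * h1 - x 1 * h0
  refine ⟨fun h => ?_, fun h => le_antisymm (key hu h) (key hv ?_)⟩
  · have hmem : ∀ w, u ⨯₃ w ∈ perp v := fun w => h ▸ mem_perp.mpr (dot_self_cross u w)
    have h0 := mem_perp.mp (hmem ![1, 0, 0])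
    have h1 := mem_perp.mp (hmem ![0, 1, 0])
    have h2 := mem_perp.mp (hmem ![0, 0, 1])
    simp only [cross_apply, vec3_dotProduct, cons_val] at h0 h1 h2
    ext k
    fin_cases k <;> simp [cross_apply]
    · linear_combination -h0
    · linear_combination -h1
    · linear_combination -h2
  · rw [← cross_anticomm, h, neg_zero]

lemma perp_inf_eq_perp_inf_iff {u v w : Fin 3 → K} (hv : u ⨯₃ v ≠ 0) (hw : u ⨯₃ w ≠ 0) :
    perp u ⊓ perp v = perp u ⊓ perp w ↔ w ⬝ᵥ u ⨯₃ v = 0 := by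
  have key : ∀ {v w : Fin 3 → K}, u ⨯₃ v ≠ 0 → w ⬝ᵥ u ⨯₃ v = 0 →
      perp u ⊓ perp v ≤ perp u ⊓ perp w := by
    rintro v w hv h x ⟨hxu, hxv⟩
    refine ⟨hxu, ?_⟩
    rw [SetLike.mem_coe, mem_perp] at *
    obtain ⟨k, hk⟩ := Function.ne_iff.mp hv
    refine (mul_eq_zero.mp (?_ : (u ⨯₃ v) k * _ = 0)).resolve_left hk
    simp only [cross_apply, vec3_dotProduct, cons_val] at *
    fin_cases k <;> simp only [Fin.zero_eta, Fin.mk_one, Fin.reduceFinMk, cons_val]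
    · linear_combination x 0 * h + (w 1 * v 2 - w 2 * v 1) * hxu + (w 2 * u 1 - w 1 * u 2) * hxv
    · linear_combination x 1 * h + (w 2 * v 0 - w 0 * v 2) * hxu + (w 0 * u 2 - w 2 * u 0) * hxv
    · linear_combination x 2 * h + (w 0 * v 1 - w 1 * v 0) * hxu + (w 1 * u 0 - w 0 * u 1) * hxv
  refine ⟨fun h => ?_, fun h => le_antisymm (key hv h) (key hw ?_)⟩
  · have : u ⨯₃ v ∈ perp u ⊓ perp v :=
      ⟨mem_perp.mpr (dot_self_cross u v), mem_perp.mpr (dot_cross_self u v)⟩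
    rw [h] at this
    exact mem_perp.mp this.2
  · simp only [cross_apply, vec3_dotProduct, cons_val] at *
    linear_combination -h

end Perp

section Pullback

variable {n : ℕ} {K : Type*} [Field K]

/-- The number of distinct intersections of `H` with the other members of `𝓐`. -/
noncomputable def restrictionCount (𝓐 : Set (Submodule K (Fin n → K)))
    (H : Submodule K (Fin n → K)) : ℕ :=
  ((fun H' => H ⊓ H') '' (𝓐 \ {H})).ncard

/-- The preimage of a subspace under an invertible matrix. -/
def pullback (g : GL (Fin n) K) (H : Submodule K (Fin n → K)) : Submodule K (Fin n → K) :=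
  H.comap (g : Matrix (Fin n) (Fin n) K).mulVecLin

lemma pullback_mul (g h : GL (Fin n) K) (H : Submodule K (Fin n → K)) :
    pullback (g * h) H = pullback h (pullback g H) := by
  simp [pullback, Matrix.mulVecLin_mul, Submodule.comap_comp]

lemma pullback_one (H : Submodule K (Fin n → K)) : pullback 1 H = H := by
  simp [pullback]

lemma pullback_inv_pullback (g : GL (Fin n) K) (H : Submodule K (Fin n → K)) :
    pullback g⁻¹ (pullback g H) = H := by
  rw [← pullback_mul, mul_inv_cancel, pullback_one]

lemma pullback_injective (g : GL (Fin n) K) : Function.Injective (pullback g) :=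
  Function.LeftInverse.injective (pullback_inv_pullback g)

lemma perp_vecMul_eq_pullback (v : Fin n → K) (g : GL (Fin n) K) :
    perp (v ᵥ* (g : Matrix (Fin n) (Fin n) K)) = pullback g (perp v) :=
  perp_vecMul v _

lemma restrictionCount_pullback {𝓐 : Set (Submodule K (Fin n → K))} {g : GL (Fin n) K}
    (hg : ∀ H ∈ 𝓐, pullback g H ∈ 𝓐) (hg' : ∀ H ∈ 𝓐, pullback g⁻¹ H ∈ 𝓐)
    (H : Submodule K (Fin n → K)) :
    restrictionCount 𝓐 (pullback g H) = restrictionCount 𝓐 H := by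
  have himage : pullback g '' 𝓐 = 𝓐 :=
    (Set.image_subset_iff.mpr hg).antisymm fun H' hH' =>
      ⟨_, hg' H' hH', by simpa using pullback_inv_pullback g⁻¹ H'⟩
  have hdiff : 𝓐 \ {pullback g H} = pullback g '' (𝓐 \ {H}) := by
    rw [Set.image_sdiff (pullback_injective g), himage, Set.image_singleton]
  rw [restrictionCount, restrictionCount, hdiff, Set.image_image,
    ← Set.ncard_image_of_injective ((fun H' => H ⊓ H') '' (𝓐 \ {H})) (pullback_injective g),
    Set.image_image]
  rfl

end Pullback

section CyclotomicIntegers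

/-- The ring `ℤ[ω]` with `ω ^ 2 = 1 + ω`. -/
abbrev GoldenInt : Type := QuadraticAlgebra ℤ 1 1

/-- The ring `ℤ[ζ]` of integers of the fifth cyclotomic field, as the quadratic extension of
`ℤ[ω]` with `ζ ^ 2 = -1 + (ω - 1) ζ`. -/
abbrev CycInt_s6 : Type := QuadraticAlgebra GoldenInt (-1) ⟨-1, 1⟩

/-- The element `a + b ω + (c + d ω) ζ` of `ℤ[ζ]`. -/
def cyc (a b c d : ℤ) : CycInt_s6 := ⟨⟨a, b⟩, ⟨c, d⟩⟩

variable {ζ : ℂ}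

lemma one_add_sum_pow_eq_zero (hζ : IsPrimitiveRoot ζ 5) :
    1 + ζ + ζ ^ 2 + ζ ^ 3 + ζ ^ 4 = 0 := by
  simpa [Finset.sum_range_succ] using hζ.geom_sum_eq_zero (by norm_num)

open scoped QuadraticAlgebra in
/-- The embedding of `ℤ[ζ]` into the complex numbers. -/
noncomputable def cycEmbedding (hζ : IsPrimitiveRoot ζ 5) : CycInt_s6 →+* ℂ where
  toFun z := z.re.re + z.re.im * (-ζ ^ 2 - ζ ^ 3) + (z.im.re + z.im.im * (-ζ ^ 2 - ζ ^ 3)) * ζ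
  map_zero' := by simp
  map_one' := by simp
  map_add' x y := by simp; ring
  map_mul' x y := by
    have h := one_add_sum_pow_eq_zero hζ
    obtain ⟨w, hw⟩ : ∃ w, w = -ζ ^ 2 - ζ ^ 3 := ⟨_, rfl⟩
    have hw_sq : w ^ 2 - 1 - w = 0 := by
      rw [hw]
      linear_combination (ζ ^ 2 + ζ - 1) * h
    have hζ_sq : ζ ^ 2 + 1 - (w - 1) * ζ = 0 := by
      rw [hw]
      linear_combination h
    obtain ⟨⟨a, b⟩, ⟨c, d⟩⟩ := x
    obtain ⟨⟨a', b'⟩, ⟨c', d'⟩⟩ := y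
    rw [← hw]
    simp only [QuadraticAlgebra.mk_mul_mk, QuadraticAlgebra.re_add,
      QuadraticAlgebra.im_add, neg_mul, one_mul, QuadraticAlgebra.neg_mk]
    push_cast
    linear_combination -(c + d * w) * (c' + d' * w) * hζ_sq +
      (-b * b' + d * d' - ζ * (b * d' + d * b' + w * d * d' + c * d' + d * c')) * hw_sq

lemma cycEmbedding_cyc (hζ : IsPrimitiveRoot ζ 5) (a b c d : ℤ) :
    cycEmbedding hζ (cyc a b c d) =
      a + b * (-ζ ^ 2 - ζ ^ 3) + (c + d * (-ζ ^ 2 - ζ ^ 3)) * ζ :=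
  rfl

lemma eq_zero_of_cubic_eq_zero (hζ : IsPrimitiveRoot ζ 5) {a b c d : ℚ}
    (h : a + b * ζ + c * ζ ^ 2 + d * ζ ^ 3 = 0) : a = 0 ∧ b = 0 ∧ c = 0 ∧ d = 0 := by
  let p : Polynomial ℚ := .C a + .C b * .X + .C c * .X ^ 2 + .C d * .X ^ 3
  have hp : Polynomial.aeval ζ p = 0 := by simpa [p] using h
  have hdeg : p.degree ≤ 3 := by
    unfold p
    compute_degree
  have hmin : (minpoly ℚ ζ).degree = 4 := by
    rw [← Polynomial.cyclotomic_eq_minpoly_rat hζ (by norm_num), Polynomial.degree_cyclotomic]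
    rfl
  have hp0 : p = 0 := by
    by_contra hne
    have := (minpoly.degree_le_of_ne_zero ℚ ζ hne hp).trans hdeg
    rw [hmin] at this
    exact absurd this (by decide)
  have hcoeff : ∀ k, p.coeff k = 0 := fun k => by simp [hp0]
  have h0 := hcoeff 0
  have h1 := hcoeff 1
  have h2 := hcoeff 2
  have h3 := hcoeff 3
  simp [p, Polynomial.coeff_X, Polynomial.coeff_C] at h0 h1 h2 h3
  exact ⟨h0, h1, h2, h3⟩

lemma cycEmbedding_injective (hζ : IsPrimitiveRoot ζ 5) :
    Function.Injective (cycEmbedding hζ) := by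
  rw [injective_iff_map_eq_zero]
  rintro ⟨⟨a, b⟩, ⟨c, d⟩⟩ hz
  change (a + b * (-ζ ^ 2 - ζ ^ 3) + (c + d * (-ζ ^ 2 - ζ ^ 3)) * ζ : ℂ) = 0 at hz
  obtain ⟨h0, h1, h2, h3⟩ := eq_zero_of_cubic_eq_zero hζ
    (a := a + d) (b := c + d) (c := d - b) (d := -b) (by
      push_cast
      linear_combination hz + d * one_add_sum_pow_eq_zero hζ)
  norm_cast at h0 h1 h2 h3
  ext <;> simp <;> omega

end CyclotomicIntegers

section Normals

/-- The generators of the reflection group `H₃`. -/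
def generator : Fin 3 → Matrix (Fin 3) (Fin 3) CycInt_s6 :=
  ![!![1, 0, 0; 0, 1, 1; 0, 0, -1],
    !![-1, 0, 0; cyc 0 1 0 0, 1, 0; 0, 0, 1],
    !![1, cyc 0 1 0 0, 0; 0, -1, 0; 0, 1, 1]]

/-- Normals of the reflection hyperplanes of `H₃`. -/
def rootNormal : Fin 15 → Fin 3 → CycInt_s6 :=
  ![![1, 0, 0],
    ![1, cyc 0 1 0 0, 0],
    ![1, cyc 0 1 0 0, cyc 0 1 0 0],
    ![1, 1, 0],
    ![1, 1, 1],
    ![cyc 0 1 0 0, 1, 0],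
    ![1, cyc 0 1 0 0, 1],
    ![cyc 0 1 0 0, 1, 1],
    ![0, 1, 0],
    ![cyc 0 1 0 0, cyc 1 1 0 0, 1],
    ![cyc 0 1 0 0, cyc 0 1 0 0, 1],
    ![0, 1, 1],
    ![cyc 0 1 0 0, cyc 0 1 0 0, cyc (-1) 1 0 0],
    ![cyc 0 1 0 0, cyc 2 0 0 0, 1],
    ![0, 0, 1]]

/-- Normals of the hyperplanes in the `H₃`-orbit of `(1, -ζ ^ 2, 0)`. -/
def extraNormal : Fin 12 → Fin 3 → CycInt_s6 :=
  ![![1, cyc 1 0 1 (-1), 0],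
    ![cyc 1 0 1 0, cyc 0 1 0 0, cyc 0 1 0 0],
    ![cyc 0 1 0 0, cyc 1 0 1 0, 0],
    ![cyc 1 0 1 0, cyc 0 0 0 1, cyc 0 0 0 1],
    ![cyc 0 0 0 1, cyc 0 0 1 1, cyc 1 0 1 0],
    ![cyc 0 1 0 0, cyc 1 1 0 0, cyc 1 0 1 0],
    ![cyc 1 0 1 0, cyc 1 0 1 0, 1],
    ![cyc 1 0 1 0, cyc 1 0 1 0, cyc 0 0 1 0],
    ![cyc 0 1 0 1, cyc 1 1 1 0, cyc 0 1 0 0],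
    ![cyc 0 1 0 1, cyc 1 0 1 1, cyc 0 0 0 1],
    ![cyc 0 0 0 1, cyc (-1) 1 0 1, cyc 0 0 1 0],
    ![cyc 0 1 0 0, cyc 0 1 (-1) 1, 1]]

/-- Normals of all hyperplanes of the arrangement. -/
def normal : Fin 15 ⊕ Fin 12 → Fin 3 → CycInt_s6 := Sum.elim rootNormal extraNormal


lemma generator_mul_self : ∀ k, generator k * generator k = 1 := by decide +kernel

lemma normal_ne_zero : ∀ i, normal i ≠ 0 := by decide +kernel

lemma normal_cross_ne_zero : ∀ i j, i ≠ j → normal i ⨯₃ normal j ≠ 0 := by decide +kernel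

lemma rootNormal_closed :
    ∀ i k, ∃ j, (rootNormal i ᵥ* generator k) ⨯₃ rootNormal j = 0 := by decide +kernel

lemma extraNormal_closed :
    ∀ i k, ∃ j, (extraNormal i ᵥ* generator k) ⨯₃ extraNormal j = 0 := by decide +kernel

lemma rootNormal_connected : ∀ i, i = 0 ∨
    ∃ j < i, ∃ k, (rootNormal j ᵥ* generator k) ⨯₃ rootNormal i = 0 := by decide +kernel

lemma extraNormal_connected : ∀ i, i = 0 ∨
    ∃ j < i, ∃ k, (extraNormal j ᵥ* generator k) ⨯₃ extraNormal i = 0 := by decide +kernel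

/-- `T` indexes normals representing each line of the restriction to the `i`-th hyperplane
exactly once. -/
def IsTransversal (i : Fin 15 ⊕ Fin 12) (T : Finset (Fin 15 ⊕ Fin 12)) : Prop :=
  i ∉ T ∧ (∀ j, j = i ∨ ∃ t ∈ T, normal t ⬝ᵥ normal i ⨯₃ normal j = 0) ∧
    ∀ s ∈ T, ∀ t ∈ T, normal t ⬝ᵥ normal i ⨯₃ normal s = 0 → s = t

lemma isTransversal_root : IsTransversal (.inl 0)
    {.inl 1, .inl 2, .inl 6, .inl 9, .inl 13, .inl 14, .inr 4, .inr 5, .inr 8, .inr 9} := by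
  unfold IsTransversal
  decide +kernel

lemma isTransversal_extra : IsTransversal (.inr 0)
    {.inl 0, .inl 2, .inl 4, .inl 6, .inl 7, .inl 9, .inl 10, .inl 11, .inl 12, .inl 13,
      .inl 14} := by
  unfold IsTransversal
  decide +kernel

end Normals

section Embedding

variable {ζ : ℂ} (hζ : IsPrimitiveRoot ζ 5)

/-- The hyperplane in `ℂ ^ 3` with a normal vector over `ℤ[ζ]`. -/
noncomputable def cycPerp (v : Fin 3 → CycInt_s6) : Submodule ℂ (Fin 3 → ℂ) :=
  perp (cycEmbedding hζ ∘ v)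

lemma comp_ne_zero {n : ℕ} {v : Fin n → CycInt_s6} (hv : v ≠ 0) : cycEmbedding hζ ∘ v ≠ 0 := by
  intro h
  exact hv (funext fun i => cycEmbedding_injective hζ (by simpa using congrFun h i))

lemma comp_cross (u v : Fin 3 → CycInt_s6) :
    (cycEmbedding hζ ∘ u) ⨯₃ (cycEmbedding hζ ∘ v) = cycEmbedding hζ ∘ (u ⨯₃ v) := by
  ext k
  fin_cases k <;> simp [cross_apply]

lemma comp_cross_eq_zero_iff {u v : Fin 3 → CycInt_s6} :
    (cycEmbedding hζ ∘ u) ⨯₃ (cycEmbedding hζ ∘ v) = 0 ↔ u ⨯₃ v = 0 := by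
  rw [comp_cross]
  refine ⟨fun h => ?_, fun h => ?_⟩
  · by_contra h'
    exact comp_ne_zero hζ h' h
  · ext k
    simp [h]

lemma cycPerp_eq_iff {u v : Fin 3 → CycInt_s6} (hu : u ≠ 0) (hv : v ≠ 0) :
    cycPerp hζ u = cycPerp hζ v ↔ u ⨯₃ v = 0 := by
  rw [cycPerp, cycPerp, perp_eq_perp_iff (comp_ne_zero hζ hu) (comp_ne_zero hζ hv),
    comp_cross_eq_zero_iff]

lemma cycPerp_inf_eq_iff {u v w : Fin 3 → CycInt_s6} (hv : u ⨯₃ v ≠ 0) (hw : u ⨯₃ w ≠ 0) :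
    cycPerp hζ u ⊓ cycPerp hζ v = cycPerp hζ u ⊓ cycPerp hζ w ↔ w ⬝ᵥ u ⨯₃ v = 0 := by
  rw [cycPerp, cycPerp, cycPerp, perp_inf_eq_perp_inf_iff
    (mt (comp_cross_eq_zero_iff hζ).mp hv) (mt (comp_cross_eq_zero_iff hζ).mp hw), comp_cross,
    ← RingHom.map_dotProduct, map_eq_zero_iff _ (cycEmbedding_injective hζ)]

lemma cycPerp_normal_injective : Function.Injective fun i => cycPerp hζ (normal i) := by
  intro i j h
  by_contra hij
  exact normal_cross_ne_zero i j hij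
    ((cycPerp_eq_iff hζ (normal_ne_zero i) (normal_ne_zero j)).mp h)

/-- The 27 hyperplanes of the arrangement. -/
def hyperplanes : Set (Submodule ℂ (Fin 3 → ℂ)) := Set.range fun i => cycPerp hζ (normal i)

lemma restrictionCount_hyperplanes {i : Fin 15 ⊕ Fin 12} {T : Finset (Fin 15 ⊕ Fin 12)}
    (hT : IsTransversal i T) :
    restrictionCount (hyperplanes hζ) (cycPerp hζ (normal i)) = T.card := by
  obtain ⟨hi, hcover, hsep⟩ := hT
  have hcross : ∀ j, j ≠ i → normal i ⨯₃ normal j ≠ 0 := fun j hj =>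
    normal_cross_ne_zero i j hj.symm
  have hne : ∀ t ∈ T, t ≠ i := fun t ht h => hi (h ▸ ht)
  have himage : (fun H' => cycPerp hζ (normal i) ⊓ H') ''
      (hyperplanes hζ \ {cycPerp hζ (normal i)}) =
      (fun t => cycPerp hζ (normal i) ⊓ cycPerp hζ (normal t)) '' T := by
    apply Set.Subset.antisymm
    · rintro _ ⟨_, ⟨⟨j, rfl⟩, hj⟩, rfl⟩
      have hj' : j ≠ i := by
        rintro rfl
        exact hj rfl
      obtain ⟨t, ht, h⟩ := (hcover j).resolve_left hj'
      exact ⟨t, ht, ((cycPerp_inf_eq_iff hζ (hcross j hj') (hcross t (hne t ht))).mpr h).symm⟩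
    · rintro _ ⟨t, ht, rfl⟩
      exact ⟨_, ⟨⟨t, rfl⟩, fun h => hne t ht (cycPerp_normal_injective hζ h)⟩, rfl⟩
  rw [restrictionCount, himage, Set.InjOn.ncard_image, Set.ncard_coe_finset]
  intro s hs t ht h
  exact hsep s hs t ht
    ((cycPerp_inf_eq_iff hζ (hcross s (hne s hs)) (hcross t (hne t ht))).mp h)

end Embedding

section Orbit

variable {ζ : ℂ} (hζ : IsPrimitiveRoot ζ 5)

lemma vecMul_generator_ne_zero {v : Fin 3 → CycInt_s6} (hv : v ≠ 0) (k : Fin 3) :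
    v ᵥ* generator k ≠ 0 := by
  intro h
  apply hv
  rw [← vecMul_one v, ← generator_mul_self k, ← vecMul_vecMul, h, zero_vecMul]

lemma cycEmbedding_comp_vecMul (v : Fin 3 → CycInt_s6) (M : Matrix (Fin 3) (Fin 3) CycInt_s6) :
    cycEmbedding hζ ∘ (v ᵥ* M) = (cycEmbedding hζ ∘ v) ᵥ* M.map (cycEmbedding hζ) :=
  funext fun i => RingHom.map_vecMul _ _ _ i

variable {γ : Fin 3 → GL (Fin 3) ℂ}
  (hγ : ∀ k, (γ k : Matrix (Fin 3) (Fin 3) ℂ) = (generator k).map (cycEmbedding hζ))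

include hγ

lemma pullback_cycPerp (k : Fin 3) (v : Fin 3 → CycInt_s6) :
    pullback (γ k) (cycPerp hζ v) = cycPerp hζ (v ᵥ* generator k) := by
  rw [cycPerp, cycPerp, ← perp_vecMul_eq_pullback, hγ, cycEmbedding_comp_vecMul]

lemma inv_eq_self (k : Fin 3) : (γ k)⁻¹ = γ k := by
  rw [inv_eq_iff_mul_eq_one]
  ext1
  rw [Units.val_mul, hγ, ← Matrix.map_mul, generator_mul_self]
  simp

lemma pullback_mem_range {m : ℕ} {N : Fin m → Fin 3 → CycInt_s6} (hN : ∀ i, N i ≠ 0)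
    (hclosed : ∀ i k, ∃ j, (N i ᵥ* generator k) ⨯₃ N j = 0)
    {g : GL (Fin 3) ℂ} (hg : g ∈ Subgroup.closure (Set.range γ)) :
    ∀ H ∈ Set.range fun i => cycPerp hζ (N i),
      pullback g H ∈ Set.range fun i => cycPerp hζ (N i) := by
  have hgen : ∀ k, ∀ H ∈ Set.range fun i => cycPerp hζ (N i),
      pullback (γ k) H ∈ Set.range fun i => cycPerp hζ (N i) := by
    rintro k _ ⟨i, rfl⟩
    obtain ⟨j, hj⟩ := hclosed i k
    refine ⟨j, ?_⟩
    simp only [pullback_cycPerp hζ hγ]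
    exact ((cycPerp_eq_iff hζ (vecMul_generator_ne_zero (hN i) k) (hN j)).mpr hj).symm
  intro H hH
  induction hg using Subgroup.closure_induction_right with
  | one => rwa [pullback_one]
  | mul_right x hx y hy ih =>
    obtain ⟨k, rfl⟩ := hy
    rw [pullback_mul]
    exact hgen k _ ih
  | mul_inv_cancel x hx y hy ih =>
    obtain ⟨k, rfl⟩ := hy
    rw [pullback_mul, inv_eq_self hζ hγ]
    exact hgen k _ ih

lemma exists_pullback_eq {m : ℕ} [NeZero m] {N : Fin m → Fin 3 → CycInt_s6} (hN : ∀ i, N i ≠ 0)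
    (hconn : ∀ i, i = 0 ∨ ∃ j < i, ∃ k, (N j ᵥ* generator k) ⨯₃ N i = 0) (i : Fin m) :
    ∃ g ∈ Subgroup.closure (Set.range γ), pullback g (cycPerp hζ (N 0)) = cycPerp hζ (N i) := by
  induction i using WellFoundedLT.induction with
  | ind i ih =>
    obtain rfl | ⟨j, hj, k, h⟩ := hconn i
    · exact ⟨1, one_mem _, pullback_one _⟩
    · obtain ⟨g, hg, hgj⟩ := ih j hj
      refine ⟨g * γ k, mul_mem hg (Subgroup.subset_closure ⟨k, rfl⟩), ?_⟩
      rw [pullback_mul, hgj, pullback_cycPerp hζ hγ]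
      exact (cycPerp_eq_iff hζ (vecMul_generator_ne_zero (hN j) k) (hN i)).mpr h

lemma pullback_mem_hyperplanes {g : GL (Fin 3) ℂ} (hg : g ∈ Subgroup.closure (Set.range γ)) :
    ∀ H ∈ hyperplanes hζ, pullback g H ∈ hyperplanes hζ := by
  rintro _ ⟨i | i, rfl⟩
  · obtain ⟨j, hj⟩ := pullback_mem_range hζ hγ (fun i => normal_ne_zero (.inl i))
      rootNormal_closed hg _ ⟨i, rfl⟩
    exact ⟨.inl j, hj⟩
  · obtain ⟨j, hj⟩ := pullback_mem_range hζ hγ (fun i => normal_ne_zero (.inr i))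
      extraNormal_closed hg _ ⟨i, rfl⟩
    exact ⟨.inr j, hj⟩

lemma restrictionCount_pullback_hyperplanes {g : GL (Fin 3) ℂ}
    (hg : g ∈ Subgroup.closure (Set.range γ)) (H : Submodule ℂ (Fin 3 → ℂ)) :
    restrictionCount (hyperplanes hζ) (pullback g H) = restrictionCount (hyperplanes hζ) H :=
  restrictionCount_pullback (pullback_mem_hyperplanes hζ hγ hg)
    (pullback_mem_hyperplanes hζ hγ (inv_mem hg)) H

lemma restrictionCount_root (i : Fin 15) :
    restrictionCount (hyperplanes hζ) (cycPerp hζ (normal (.inl i))) = 10 := by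
  obtain ⟨g, hg, h⟩ := exists_pullback_eq hζ hγ (fun i => normal_ne_zero (.inl i))
    rootNormal_connected i
  exact h ▸ (restrictionCount_pullback_hyperplanes hζ hγ hg _).trans
    (restrictionCount_hyperplanes hζ isTransversal_root)

lemma restrictionCount_extra (i : Fin 12) :
    restrictionCount (hyperplanes hζ) (cycPerp hζ (normal (.inr i))) = 11 := by
  obtain ⟨g, hg, h⟩ := exists_pullback_eq hζ hγ (fun i => normal_ne_zero (.inr i))
    extraNormal_connected i
  exact h ▸ (restrictionCount_pullback_hyperplanes hζ hγ hg _).trans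
    (restrictionCount_hyperplanes hζ isTransversal_extra)

lemma perp_image_orbits : perp ''
      ({w | ∃ g ∈ Subgroup.closure (Set.range γ), ∃ i : Fin 3,
          w = Pi.single i 1 ᵥ* (g : Matrix (Fin 3) (Fin 3) ℂ)} ∪
        {w | ∃ g ∈ Subgroup.closure (Set.range γ),
          w = ![1, -ζ ^ 2, 0] ᵥ* (g : Matrix (Fin 3) (Fin 3) ℂ)}) = hyperplanes hζ := by
  have hroot : ∀ i : Fin 3, Pi.single i 1 = cycEmbedding hζ ∘ rootNormal (![0, 8, 14] i) := by
    intro i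
    ext j
    fin_cases i <;> fin_cases j <;> simp [rootNormal]
  have hextra : ![1, -ζ ^ 2, 0] = cycEmbedding hζ ∘ extraNormal 0 := by
    ext j
    fin_cases j <;> simp [extraNormal, cycEmbedding_cyc]
    linear_combination -one_add_sum_pow_eq_zero hζ
  apply Set.Subset.antisymm
  · rintro _ ⟨_, ⟨g, hg, i, rfl⟩ | ⟨g, hg, rfl⟩, rfl⟩
    · rw [perp_vecMul_eq_pullback, hroot]
      exact pullback_mem_hyperplanes hζ hγ hg _ ⟨.inl _, rfl⟩
    · rw [perp_vecMul_eq_pullback, hextra]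
      exact pullback_mem_hyperplanes hζ hγ hg _ ⟨.inr 0, rfl⟩
  · rintro _ ⟨i | i, rfl⟩
    · obtain ⟨g, hg, h⟩ := exists_pullback_eq hζ hγ (fun i => normal_ne_zero (.inl i))
        rootNormal_connected i
      exact ⟨_, .inl ⟨g, hg, 0, rfl⟩, by rw [perp_vecMul_eq_pullback, hroot]; exact h⟩
    · obtain ⟨g, hg, h⟩ := exists_pullback_eq hζ hγ (fun i => normal_ne_zero (.inr i))
        extraNormal_connected i
      exact ⟨_, .inr ⟨g, hg, rfl⟩, by rw [perp_vecMul_eq_pullback, hextra]; exact h⟩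

end Orbit

end Arrgt

open Arrgt in
/-- In the 27-hyperplane arrangement `𝓐`, every restriction `𝓐^H` has 10 or 11
elements; exactly 15 hyperplanes have `|𝓐^H| = 10` and exactly 12 have `|𝓐^H| = 11`. -/
theorem H3A_restriction_counts
    (ζ : ℂ) (hζ : IsPrimitiveRoot ζ 5)
    (g1 g2 g3 : GL (Fin 3) ℂ)
    (hg1 : (g1 : Matrix (Fin 3) (Fin 3) ℂ) = !![1, 0, 0; 0, 1, 1; 0, 0, -1])
    (hg2 : (g2 : Matrix (Fin 3) (Fin 3) ℂ) = !![-1, 0, 0; -ζ^2 - ζ^3, 1, 0; 0, 0, 1])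
    (hg3 : (g3 : Matrix (Fin 3) (Fin 3) ℂ) = !![1, -ζ^2 - ζ^3, 0; 0, -1, 0; 0, 1, 1])
    (W : Subgroup (GL (Fin 3) ℂ)) (hW : W = Subgroup.closure {g1, g2, g3})
    (R : Set (Fin 3 → ℂ))
    (hR : R = {w | ∃ g ∈ W, ∃ i : Fin 3,
          w = Matrix.vecMul (Pi.single i 1) (g : Matrix (Fin 3) (Fin 3) ℂ)} ∪
        {w | ∃ g ∈ W, w = Matrix.vecMul ![1, -ζ^2, 0] (g : Matrix (Fin 3) (Fin 3) ℂ)})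
    (𝓐 : Set (Submodule ℂ (Fin 3 → ℂ))) (h𝓐 : 𝓐 = Arrgt.perp '' R)
    :
    (∀ H ∈ 𝓐, ((fun H' => H ⊓ H') '' (𝓐 \ {H})).ncard ∈ ({10, 11} : Set ℕ)) ∧
      {H ∈ 𝓐 | ((fun H' => H ⊓ H') '' (𝓐 \ {H})).ncard = 10}.ncard = 15 ∧
      {H ∈ 𝓐 | ((fun H' => H ⊓ H') '' (𝓐 \ {H})).ncard = 11}.ncard = 12 := by
  have hγ : ∀ k, ((![g1, g2, g3] k : GL (Fin 3) ℂ) : Matrix (Fin 3) (Fin 3) ℂ) =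
      (generator k).map (cycEmbedding hζ) := by
    intro k
    ext i j
    fin_cases k <;> fin_cases i <;> fin_cases j <;>
      simp [hg1, hg2, hg3, generator, cycEmbedding_cyc]
  have hrange : ({g1, g2, g3} : Set (GL (Fin 3) ℂ)) = Set.range ![g1, g2, g3] := by
    ext g
    simp [eq_comm]
    tauto
  have h𝓐' : 𝓐 = hyperplanes hζ := by
    rw [h𝓐, hR, hW, hrange]
    exact perp_image_orbits hζ hγ
  clear h𝓐
  subst h𝓐'
  have hroot := restrictionCount_root hζ hγ
  have hextra := restrictionCount_extra hζ hγ
  have hinj := cycPerp_normal_injective hζ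
  refine ⟨?_, ?_, ?_⟩
  · rintro _ ⟨i | i, rfl⟩
    · exact .inl (hroot i)
    · exact .inr (hextra i)
  · have hset : {H ∈ hyperplanes hζ | restrictionCount (hyperplanes hζ) H = 10} =
        Set.range fun i => cycPerp hζ (normal (.inl i)) := by
      ext H
      constructor
      · rintro ⟨⟨i | i, rfl⟩, h⟩
        · exact ⟨i, rfl⟩
        · exact absurd ((hextra i).symm.trans h) (by norm_num)
      · rintro ⟨i, rfl⟩
        exact ⟨⟨_, rfl⟩, hroot i⟩
    refine (congrArg Set.ncard hset).trans ?_
    exact (Set.ncard_range_of_injective (hinj.comp Sum.inl_injective)).trans (Nat.card_fin _)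
  · have hset : {H ∈ hyperplanes hζ | restrictionCount (hyperplanes hζ) H = 11} =
        Set.range fun i => cycPerp hζ (normal (.inr i)) := by
      ext H
      constructor
      · rintro ⟨⟨i | i, rfl⟩, h⟩
        · exact absurd ((hroot i).symm.trans h) (by norm_num)
        · exact ⟨i, rfl⟩
      · rintro ⟨i, rfl⟩
        exact ⟨⟨_, rfl⟩, hextra i⟩
    refine (congrArg Set.ncard hset).trans ?_
    exact (Set.ncard_range_of_injective (hinj.comp Sum.inr_injective)).trans (Nat.card_fin _)
end
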